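/- For every infinite cardinal λ that is smaller than the first fixed point of the aleph function (the least cardinal α with α = ℵ_α > ℵ₀), there exists an abelian group which is λ-free but not free. -/

import Mathlib

open Cardinal

/-- A bundled abelian group. -/
structure BundledAbGroup where
  carrier : Type
  [str : AddCommGroup carrier]

attribute [instance] BundledAbGroup.str

/-- A subgroup of a free abelian group of arbitrary rank is free. -/
theorem free_int_submodule {M : Type*} [AddCommGroup M] [Module.Free ℤ M] (N : Submodule ℤ M) :
    Module.Free ℤ N := by
  classical
  obtain ⟨⟨ι, b⟩⟩ := Module.Free.exists_basis (R := ℤ) (M := M)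
  obtain ⟨_, hwf⟩ := exists_wellFoundedLT ι
  let P : ι → Submodule ℤ N := fun i =>
    { carrier := {v | ∀ j, i < j → b.repr (v : M) j = 0}
      add_mem' := by
        intro v w hv hw j hj
        simp [hv j hj, hw j hj]
      zero_mem' := by simp
      smul_mem' := by
        intro c v hv j hj
        simp [hv j hj] }
  have hP : ∀ i v, v ∈ P i ↔ ∀ j, i < j → b.repr (v : M) j = 0 := fun i v => Iff.rfl
  let C : ι → N →ₗ[ℤ] ℤ := fun i => (b.coord i).comp N.subtype
  have hC : ∀ i v, C i v = b.repr (v : M) i := fun i v => rfl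
  have key : ∀ i, ∃ n ∈ P i, ∀ v ∈ P i, ∃ k : ℤ, C i v = k * C i n := by
    intro i
    let I : Ideal ℤ := (P i).map (C i)
    obtain ⟨c, hc⟩ := (IsPrincipalIdealRing.principal I).principal
    have hcm : c ∈ I := by rw [hc]; exact Submodule.mem_span_singleton_self c
    obtain ⟨n, hn, hnc⟩ := hcm
    refine ⟨n, hn, fun v hv => ?_⟩
    have : C i v ∈ I := ⟨v, hv, rfl⟩
    rw [hc, Submodule.mem_span_singleton] at this
    obtain ⟨k, hk⟩ := this
    exact ⟨k, by rw [← hk, hnc, smul_eq_mul]⟩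
  choose n hnP hn using key
  let J := {i // C i (n i) ≠ 0}
  have hli : LinearIndependent ℤ (fun i : J => n i) := by
    rw [linearIndependent_iff']
    intro s g hg
    by_contra! hcon
    obtain ⟨i1, hi1, hgi1⟩ := hcon
    obtain ⟨i, hi⟩ := (s.filter (g · ≠ 0)).exists_maximal ⟨i1, by simp [hi1, hgi1]⟩
    have him : i ∈ s ∧ g i ≠ 0 := by simpa using hi.1
    have h0 := congrArg (C i) hg
    rw [map_sum, map_zero, Finset.sum_eq_single i] at h0
    · rw [map_smul, smul_eq_mul, mul_eq_zero] at h0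
      exact h0.elim him.2 i.2
    · intro j hj hji
      by_cases hgj : g j = 0
      · simp [hgj]
      · have hji' : (j : ι) < i := by
          rcases lt_trichotomy (j : ι) i with h | h | h
          · exact h
          · exact absurd (Subtype.ext h) hji
          · exact absurd (hi.2 (show j ∈ _ by simp [hj, hgj]) h.le) (not_le.2 h)
        rw [map_smul, hC, hnP j i hji', smul_zero]
    · exact fun h => absurd him.1 h
  have hsp : ∀ i, ∀ v ∈ P i, v ∈ Submodule.span ℤ (Set.range fun i : J => n i) := by
    intro i
    induction i using WellFoundedLT.induction with
    | ind i ih =>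
    intro v hv
    have aux : ∀ v ∈ P i, C i v = 0 → v ∈ Submodule.span ℤ (Set.range fun i : J => n i) := by
      intro w hw hw0
      by_cases hwz : w = 0
      · simp [hwz]
      have hs : (b.repr (w : M)).support.Nonempty := by
        rw [Finsupp.support_nonempty_iff]
        simpa using hwz
      have hmem := Finset.max'_mem _ hs
      set j := (b.repr (w : M)).support.max' hs
      rw [Finsupp.mem_support_iff] at hmem
      refine ih j ?_ w ?_
      · rcases lt_trichotomy j i with h | h | h
        · exact h
        · rw [h] at hmem; exact absurd hw0 hmem
        · exact absurd (hw j h) hmem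
      · intro l hl
        by_contra hne
        exact absurd (Finset.le_max' _ l (Finsupp.mem_support_iff.2 hne)) (not_le.2 hl)
    obtain ⟨k, hk⟩ := hn i v hv
    by_cases hci : C i (n i) = 0
    · exact aux v hv (by rw [hk, hci, mul_zero])
    · have h1 := aux (v - k • n i) (Submodule.sub_mem _ hv (Submodule.smul_mem _ _ (hnP i)))
        (by rw [map_sub, map_smul, hk, smul_eq_mul, sub_self])
      have h2 : n i ∈ Submodule.span ℤ (Set.range fun i : J => n i) :=
        Submodule.subset_span ⟨⟨i, hci⟩, rfl⟩
      simpa using Submodule.add_mem _ h1 (Submodule.smul_mem _ k h2)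
  refine Module.Free.of_basis (Module.Basis.mk hli ?_)
  intro v _
  by_cases hvz : v = 0
  · simp [hvz]
  have hs : (b.repr (v : M)).support.Nonempty := by
    rw [Finsupp.support_nonempty_iff]
    simpa using hvz
  refine hsp ((b.repr (v : M)).support.max' hs) v fun l hl => ?_
  by_contra hne
  exact absurd (Finset.le_max' _ l (Finsupp.mem_support_iff.2 hne)) (not_le.2 hl)

theorem free_of_injective {M N : Type*} [AddCommGroup M] [AddCommGroup N] [Module.Free ℤ N]
    (f : M →ₗ[ℤ] N) (hf : Function.Injective f) : Module.Free ℤ M :=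
  have := free_int_submodule (LinearMap.range f)
  Module.Free.of_equiv (LinearEquiv.ofInjective f hf).symm

theorem free_quotient_ker {M N : Type*} [AddCommGroup M] [AddCommGroup N] [Module.Free ℤ N]
    (f : M →ₗ[ℤ] N) : Module.Free ℤ (M ⧸ LinearMap.ker f) :=
  have := free_int_submodule (LinearMap.range f)
  Module.Free.of_equiv f.quotKerEquivRange.symm

theorem free_quotient_span_basis {M ι : Type*} [AddCommGroup M] (b : Module.Basis ι ℤ M)
    (s : Set ι) : Module.Free ℤ (M ⧸ Submodule.span ℤ (b '' s)) := by
  classical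
  have : Module.Free ℤ M := Module.Free.of_basis b
  let p : M →ₗ[ℤ] M := b.constr ℤ fun i => if i ∈ s then 0 else b i
  have hp : ∀ i, p (b i) = if i ∈ s then 0 else b i := fun i => b.constr_basis ℤ _ i
  have hker : LinearMap.ker p = Submodule.span ℤ (b '' s) := by
    apply le_antisymm
    · have h1 : ∀ v, v - p v ∈ Submodule.span ℤ (b '' s) := by
        have h2 : (Submodule.span ℤ (b '' s)).mkQ.comp (LinearMap.id - p) = 0 := by
          refine b.ext fun i => ?_
          simp only [LinearMap.comp_apply, LinearMap.sub_apply, LinearMap.id_apply, hp,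
            Submodule.mkQ_apply, LinearMap.zero_apply, Submodule.Quotient.mk_eq_zero]
          split_ifs with h
          · rw [sub_zero]; exact Submodule.subset_span ⟨i, h, rfl⟩
          · simp
        intro v
        have h3 := LinearMap.congr_fun h2 v
        rwa [LinearMap.comp_apply, Submodule.mkQ_apply, LinearMap.zero_apply,
          Submodule.Quotient.mk_eq_zero] at h3
      intro v hv
      have := h1 v
      rwa [LinearMap.mem_ker.1 hv, sub_zero] at this
    · rw [Submodule.span_le]
      rintro _ ⟨i, hi, rfl⟩
      simp [hp, hi]
  rw [← hker]
  exact free_quotient_ker p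

/-- An endomorphism strictly decreasing a well-founded rank on a basis differs from the identity
by an automorphism. -/
theorem bijective_sub_of_rank_lt {M ι ρ : Type*} [AddCommGroup M] (b : Module.Basis ι ℤ M)
    [LinearOrder ρ] [WellFoundedLT ρ] (rk : ι → ρ) (N : M →ₗ[ℤ] M)
    (hN : ∀ i, N (b i) ∈ Submodule.span ℤ (b '' {j | rk j < rk i})) :
    Function.Bijective (LinearMap.id - N : M →ₗ[ℤ] M) := by
  classical
  constructor
  · rw [← LinearMap.ker_eq_bot, LinearMap.ker_eq_bot']
    intro v hv
    by_contra hv0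
    have hvN : N v = v := by
      have : v - N v = 0 := by simpa using hv
      exact (sub_eq_zero.1 this).symm
    have hs : (b.repr v).support.Nonempty := by
      rw [Finsupp.support_nonempty_iff]
      simpa using hv0
    obtain ⟨i, hi, hmax⟩ := Finset.exists_max_image _ rk hs
    have h1 : N v ∈ Submodule.span ℤ (b '' {j | rk j < rk i}) := by
      have hv1 : N v = N (Finsupp.linearCombination ℤ b (b.repr v)) := by
        rw [b.linearCombination_repr]
      rw [hv1, Finsupp.linearCombination_apply, Finsupp.sum, map_sum]
      refine Submodule.sum_mem _ fun j hj => ?_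
      rw [map_smul]
      refine Submodule.smul_mem _ _ (Submodule.span_mono ?_ (hN j))
      exact Set.image_mono fun l (hl : rk l < rk j) => lt_of_lt_of_le hl (hmax j hj)
    rw [hvN, Module.Basis.mem_span_image] at h1
    exact lt_irrefl _ (h1 hi)
  · rw [← LinearMap.range_eq_top, eq_top_iff, ← b.span_eq, Submodule.span_le]
    have : ∀ x, ∀ i, rk i = x → b i ∈ LinearMap.range (LinearMap.id - N : M →ₗ[ℤ] M) := by
      intro x
      induction x using WellFoundedLT.induction with
      | ind x ih =>
      intro i hi
      have h1 : N (b i) ∈ LinearMap.range (LinearMap.id - N : M →ₗ[ℤ] M) := by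
        refine (Submodule.span_le.2 ?_) (hN i)
        rintro _ ⟨j, hj, rfl⟩
        exact ih (rk j) (hi ▸ hj) j rfl
      have h2 : b i = (LinearMap.id - N : M →ₗ[ℤ] M) (b i) + N (b i) := by simp
      rw [h2]
      exact Submodule.add_mem _ ⟨_, rfl⟩ h1
    rintro _ ⟨i, rfl⟩
    exact this _ i rfl

theorem free_quotient_of_rank_lt {M ι ρ : Type*} [AddCommGroup M] (b : Module.Basis ι ℤ M)
    [LinearOrder ρ] [WellFoundedLT ρ] (rk : ι → ρ) (N : M →ₗ[ℤ] M)
    (hN : ∀ i, N (b i) ∈ Submodule.span ℤ (b '' {j | rk j < rk i})) (s : Set ι)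
    (W : Submodule ℤ M) (hW : W = Submodule.span ℤ ((fun i => b i - N (b i)) '' s)) :
    Module.Free ℤ (M ⧸ W) := by
  let e := LinearEquiv.ofBijective _ (bijective_sub_of_rank_lt b rk N hN)
  have := free_quotient_span_basis (b.map e) s
  have h2 : ((b.map e : Module.Basis ι ℤ M) : ι → M) = fun i => b i - N (b i) := by
    funext i; simp [e]
  rw [h2] at this
  rwa [hW]

theorem exists_basis_extending.{u, v} {F : Type u} {T : Type v} [AddCommGroup F] (r : T → F)
    (B : Set T) (hr : LinearIndependent ℤ (fun t : B => r t))
    (hfree : Module.Free ℤ (F ⧸ Submodule.span ℤ (r '' B))) :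
    ∃ (Q : Type u) (b : Module.Basis (B ⊕ Q) ℤ F), ∀ t : B, b (Sum.inl t) = r t := by
  have hrange : Set.range (fun t : B => r t) = r '' B := by
    ext; simp
  rw [← hrange] at hfree
  obtain ⟨⟨Q, bq⟩⟩ := hfree.exists_basis
  exact ⟨Q, (Module.Basis.span hr).sumQuot bq, fun t => by
    simp [Module.Basis.sumQuot_inl, Module.Basis.span_apply]⟩

/-- The relation gluing the relation `r t` in the copy of `F` indexed by `δ` to the generator
`χ δ t`. -/
noncomputable def gluedRel {D T Z F : Type} [AddCommGroup F] (r : T → F) (χ : D → T → Z)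
    (p : D × T) : (D →₀ F) × (Z →₀ ℤ) :=
  (Finsupp.single p.1 (r p.2), -Finsupp.single (χ p.1 p.2) 1)

theorem free_quotient_gluedRel {D T Z F : Type} [AddCommGroup F] (g : D → Ordinal.{0})
    (hg : Function.Injective g) (r : T → F) (hr : LinearIndependent ℤ r) (χ : D → T → Z)
    (hχ : ∀ δ t δ' t', χ δ t = χ δ' t' → t = t') (B : Set (D × T))
    (hB : ∀ δ, Module.Free ℤ (F ⧸ Submodule.span ℤ (r '' {t | (δ, t) ∈ B ∧
      ∃ δ', g δ' < g δ ∧ (δ', t) ∈ B ∧ χ δ' t = χ δ t}))) :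
    Module.Free ℤ (((D →₀ F) × (Z →₀ ℤ)) ⧸ Submodule.span ℤ (gluedRel r χ '' B)) := by
  classical
  set O : D → Set T := fun δ => {t | (δ, t) ∈ B ∧
      ∃ δ', g δ' < g δ ∧ (δ', t) ∈ B ∧ χ δ' t = χ δ t} with hO
  have hex : ∀ δ, ∃ (Q : Type) (b : Module.Basis (O δ ⊕ Q) ℤ F), ∀ t : O δ, b (Sum.inl t) = r t :=
    fun δ => exists_basis_extending r (O δ) (hr.comp _ Subtype.val_injective) (hB δ)
  choose Q bF hbF using hex
  let b : Module.Basis ((Σ δ, O δ ⊕ Q δ) ⊕ Z) ℤ ((D →₀ F) × (Z →₀ ℤ)) :=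
    (Finsupp.basis bF).prod Finsupp.basisSingleOne
  have hb1 : ∀ δ x, b (Sum.inl ⟨δ, x⟩) = (Finsupp.single δ (bF δ x), 0) := by
    intro δ x; simp [b, Finsupp.coe_basis]
  have hb2 : ∀ z, b (Sum.inr z) = (0, Finsupp.single z 1) := by
    intro z; simp [b]
  let New : Z → D × T → Prop := fun z p => p ∈ B ∧ p.2 ∉ O p.1 ∧ χ p.1 p.2 = z
  have hNew : ∀ z p p', New z p → New z p' → p = p' := by
    rintro z ⟨δ, t⟩ ⟨δ', t'⟩ ⟨h1, h2, h3⟩ ⟨h1', h2', h3'⟩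
    dsimp only at h1 h2 h3 h1' h2' h3'
    obtain rfl := hχ _ _ _ _ (h3.trans h3'.symm)
    have h4 : g δ = g δ' := by
      rcases lt_trichotomy (g δ) (g δ') with h | h | h
      · exact absurd ⟨h1', δ, h, h1, h3.trans h3'.symm⟩ h2'
      · exact h
      · exact absurd ⟨h1, δ', h, h1', h3'.trans h3.symm⟩ h2
    rw [hg h4]
  let N : ((D →₀ F) × (Z →₀ ℤ)) →ₗ[ℤ] ((D →₀ F) × (Z →₀ ℤ)) := b.constr ℤ
    (Sum.elim (fun p => Sum.elim (fun t : O p.1 => (0, Finsupp.single (χ p.1 t) 1)) (fun _ => 0) p.2)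
      fun z => if h : ∃ p, New z p then (Finsupp.single h.choose.1 (r h.choose.2), 0) else 0)
  have hN1 : ∀ δ (t : O δ), N (b (Sum.inl ⟨δ, Sum.inl t⟩)) = (0, Finsupp.single (χ δ t) 1) :=
    fun δ t => by rw [b.constr_basis]; rfl
  have hN2 : ∀ δ q, N (b (Sum.inl ⟨δ, Sum.inr q⟩)) = 0 :=
    fun δ t => by rw [b.constr_basis]; rfl
  have hN3 : ∀ z p, New z p → N (b (Sum.inr z)) = (Finsupp.single p.1 (r p.2), 0) := by
    intro z p hp
    have h : ∃ p, New z p := ⟨p, hp⟩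
    rw [b.constr_basis, hNew z p h.choose hp h.choose_spec]
    simp only [Sum.elim_inr]
    rw [dif_pos h]
  have hN4 : ∀ z, (¬ ∃ p, New z p) → N (b (Sum.inr z)) = 0 := by
    intro z h
    rw [b.constr_basis]
    simp only [Sum.elim_inr]
    rw [dif_neg h]
  let rk : (Σ δ, O δ ⊕ Q δ) ⊕ Z → Ordinal.{0} ×ₗ ℕ :=
    Sum.elim (fun p => Sum.elim (fun _ => toLex (g p.1, 1)) (fun _ => toLex (g p.1, 0)) p.2)
      fun z => if h : ∃ p, New z p then toLex (g h.choose.1, 2) else toLex (0, 0)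
  have hrk3 : ∀ z p, New z p → rk (Sum.inr z) = toLex (g p.1, 2) := by
    intro z p hp
    have h : ∃ p, New z p := ⟨p, hp⟩
    rw [hNew z p h.choose hp h.choose_spec]
    exact dif_pos h
  have hrk4 : ∀ z, (¬ ∃ p, New z p) → rk (Sum.inr z) = toLex (0, 0) := fun z h => dif_neg h
  have hmin : ∀ δ t, (δ, t) ∈ B → ∃ δ', g δ' ≤ g δ ∧ New (χ δ t) (δ', t) := by
    intro δ t hδ
    obtain ⟨δ', ⟨h1, h2⟩, h3⟩ := (InvImage.wf g Ordinal.lt_wf).has_min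
      {δ' | (δ', t) ∈ B ∧ χ δ' t = χ δ t} ⟨δ, hδ, rfl⟩
    refine ⟨δ', not_lt.1 (h3 δ ⟨hδ, rfl⟩), h1, ?_, h2⟩
    rintro ⟨_, δ'', h4, h5, h6⟩
    exact h3 δ'' ⟨h5, h6.trans h2⟩ h4
  refine free_quotient_of_rank_lt b rk N ?_
    ({x | ∃ δ, ∃ t : O δ, x = Sum.inl ⟨δ, Sum.inl t⟩} ∪ {x | ∃ z, x = Sum.inr z ∧ ∃ p, New z p})
    _ ?_
  · rintro (⟨δ, t | q⟩ | z)
    · rw [hN1, ← hb2]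
      obtain ⟨hB1, δ', h1, h2, h3⟩ := t.2
      obtain ⟨δ'', h4, h5⟩ := hmin δ' t h2
      rw [h3] at h5
      refine Submodule.subset_span ⟨_, ?_, rfl⟩
      change rk _ < rk _
      rw [hrk3 _ _ h5]
      exact Prod.Lex.toLex_lt_toLex.2 (Or.inl (h4.trans_lt h1))
    · rw [hN2]; exact Submodule.zero_mem _
    · by_cases h : ∃ p, New z p
      · obtain ⟨p, hp⟩ := h
        rw [hN3 z p hp]
        let ψ : F →ₗ[ℤ] (D →₀ F) × (Z →₀ ℤ) :=
          (LinearMap.inl ℤ _ _).comp (Finsupp.lsingle p.1)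
        change ψ (r p.2) ∈ _
        have h1 : r p.2 ∈ Submodule.span ℤ (Set.range (bF p.1)) := by
          rw [(bF p.1).span_eq]; trivial
        have h2 := Submodule.mem_map_of_mem (f := ψ) h1
        rw [Submodule.map_span] at h2
        refine Submodule.span_mono ?_ h2
        rintro _ ⟨_, ⟨x, rfl⟩, rfl⟩
        refine ⟨Sum.inl ⟨p.1, x⟩, ?_, hb1 _ _⟩
        change rk _ < rk _
        rw [hrk3 _ _ hp]
        rcases x with t | q
        · exact Prod.Lex.toLex_lt_toLex.2 (Or.inr ⟨rfl, by simp⟩)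
        · exact Prod.Lex.toLex_lt_toLex.2 (Or.inr ⟨rfl, by simp⟩)
      · rw [hN4 z h]; exact Submodule.zero_mem _
  · have hold : ∀ δ (t : O δ), b (Sum.inl ⟨δ, Sum.inl t⟩) - N (b (Sum.inl ⟨δ, Sum.inl t⟩)) =
        gluedRel r χ (δ, t) := by
      intro δ t
      rw [hN1, hb1, hbF]
      simp [gluedRel]
    have hnew : ∀ z p, New z p → b (Sum.inr z) - N (b (Sum.inr z)) = - gluedRel r χ p := by
      intro z p hp
      rw [hN3 z p hp, hb2, gluedRel, hp.2.2]
      simp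
    apply le_antisymm
    · rw [Submodule.span_le]
      rintro _ ⟨⟨δ, t⟩, hp, rfl⟩
      by_cases ht : t ∈ O δ
      · exact Submodule.subset_span ⟨_, Or.inl ⟨δ, ⟨t, ht⟩, rfl⟩, hold δ ⟨t, ht⟩⟩
      · have h1 : New (χ δ t) (δ, t) := ⟨hp, ht, rfl⟩
        rw [SetLike.mem_coe, ← neg_neg (gluedRel r χ _), ← hnew _ _ h1]
        exact Submodule.neg_mem _ (Submodule.subset_span ⟨_, Or.inr ⟨_, rfl, _, h1⟩, rfl⟩)
    · rw [Submodule.span_le]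
      rintro _ ⟨_, (⟨δ, t, rfl⟩ | ⟨z, rfl, p, hp⟩), rfl⟩
      · dsimp only
        rw [hold]
        exact Submodule.subset_span ⟨_, t.2.1, rfl⟩
      · dsimp only
        rw [hnew _ _ hp]
        exact Submodule.neg_mem _ (Submodule.subset_span ⟨_, hp.1, rfl⟩)

/-- A well-order of regular cardinality all of whose proper initial segments are smaller. -/
class RegularOrder (X : Type) [LinearOrder X] : Prop extends WellFoundedLT X where
  aleph0_le : ℵ₀ ≤ #X
  mk_Iio_lt (x : X) : #(Set.Iio x) < #X
  exists_bound (s : Set X) : #s < #X → ∃ y, ∀ x ∈ s, x < y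

theorem regularOrder_toType {c : Cardinal.{0}} (hc : c.IsRegular) :
    RegularOrder c.ord.ToType where
  aleph0_le := by simpa using hc.1
  mk_Iio_lt x := by
    exact Cardinal.mk_Iio_lt x (by simp)
  exists_bound s hs := by
    have h1 : ¬ IsCofinal s := by
      intro h
      have h2 := Order.cof_le h
      rw [Ordinal.cof_toType, hc.cof_ord] at h2
      simp only [mk_ord_toType] at hs
      exact absurd hs (not_lt.2 h2)
    simpa [IsCofinal] using h1

instance : RegularOrder ℕ where
  aleph0_le := by simp
  mk_Iio_lt x := by simp
  exists_bound s hs := by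
    rw [Cardinal.mk_nat, Cardinal.lt_aleph0_iff_set_finite] at hs
    obtain ⟨y, hy⟩ := hs.bddAbove
    exact ⟨y + 1, fun x hx => Nat.lt_succ_of_le (hy hx)⟩

namespace RegularOrder

variable {X : Type} [LinearOrder X] [RegularOrder X]

theorem nonempty' (X : Type) [LinearOrder X] [RegularOrder X] : Nonempty X :=
  Cardinal.mk_ne_zero_iff.1 (Cardinal.aleph0_pos.trans_le (aleph0_le (X := X))).ne'

theorem exists_bound_range {ι : Type} (f : ι → X) (h : #ι < #X) : ∃ y, ∀ i, f i < y := by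
  obtain ⟨y, hy⟩ := exists_bound (Set.range f) (Cardinal.mk_range_le.trans_lt h)
  exact ⟨y, fun i => hy _ ⟨i, rfl⟩⟩

instance : NoMaxOrder X where
  exists_gt x := by
    obtain ⟨y, hy⟩ := exists_bound ({x} : Set X)
      (by simpa using Cardinal.one_lt_aleph0.trans_le aleph0_le)
    exact ⟨y, hy x rfl⟩

theorem mk_Iic_lt (x : X) : #(Set.Iic x) < #X := by
  obtain ⟨y, hy⟩ := exists_gt x
  exact (Cardinal.mk_le_mk_of_subset fun z hz => lt_of_le_of_lt hz hy).trans_lt (mk_Iio_lt y)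

end RegularOrder

/-- There is a family of relations, doubly filtered by `K` and `Th`, such that the quotient by any
bounded set of relations is free, while the full quotient is not. -/
def HasSys (K Th : Type) [LinearOrder K] [LinearOrder Th] : Prop :=
  ∃ (T F : Type) (_ : AddCommGroup F) (r : T → F) (i : T → K) (x : T → Th),
    LinearIndependent ℤ r ∧ #T ≤ #Th ∧ #F ≤ #Th ∧
    (∀ i₀ x₀ (B : Set T), (∀ t ∈ B, i t < i₀ ∨ x t < x₀) →
      Module.Free ℤ (F ⧸ Submodule.span ℤ (r '' B))) ∧
    ¬ Module.Free ℤ (F ⧸ Submodule.span ℤ (Set.range r))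

theorem HasSys.diagonal {K Th : Type} [LinearOrder K] [LinearOrder Th] [Nonempty K]
    (h : HasSys K Th) : HasSys Th Th := by
  obtain ⟨T, F, _, r, i, x, h1, h2, h3, h4, h5⟩ := h
  obtain ⟨i₀⟩ := ‹Nonempty K›
  refine ⟨T, F, _, r, x, x, h1, h2, h3, fun a b B hB => h4 i₀ (max a b) B fun t ht => ?_, h5⟩
  exact Or.inr (lt_max_iff.2 (hB t ht))

theorem exists_mem_span_bounded {X T F : Type} [LinearOrder X] [NoMaxOrder X] [Nonempty X]
    [AddCommGroup F] (r : T → F) (x : T → X) {v : F} (hv : v ∈ Submodule.span ℤ (Set.range r)) :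
    ∃ ξ, v ∈ Submodule.span ℤ (r '' {t | x t < ξ}) := by
  induction hv using Submodule.span_induction with
  | mem v hv =>
    obtain ⟨t, rfl⟩ := hv
    obtain ⟨y, hy⟩ := exists_gt (x t)
    exact ⟨y, Submodule.subset_span ⟨t, hy, rfl⟩⟩
  | zero => exact ⟨Classical.arbitrary X, Submodule.zero_mem _⟩
  | add v w _ _ hv hw =>
    obtain ⟨y, hy⟩ := hv
    obtain ⟨z, hz⟩ := hw
    refine ⟨max y z, Submodule.add_mem _ (Submodule.span_mono ?_ hy) (Submodule.span_mono ?_ hz)⟩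
    · exact Set.image_mono fun t (ht : x t < y) => lt_max_of_lt_left ht
    · exact Set.image_mono fun t (ht : x t < z) => lt_max_of_lt_right ht
  | smul c v _ hv =>
    obtain ⟨y, hy⟩ := hv
    exact ⟨y, Submodule.smul_mem _ _ hy⟩

theorem HasSys.exists_group {K L : Type} [LinearOrder K] [LinearOrder L] [Nonempty K]
    [RegularOrder L] (h : HasSys K L) :
    ∃ (G : Type) (_ : AddCommGroup G), (∀ H : AddSubgroup G, #H < #L → Module.Free ℤ H) ∧
      ¬ Module.Free ℤ G := by
  obtain ⟨T, F, _, r, i, x, h1, h2, h3, h4, h5⟩ := h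
  have := RegularOrder.nonempty' L
  refine ⟨_, inferInstance, fun H hH => ?_, h5⟩
  have hlift : ∀ h : H, ∃ v : F, (Submodule.span ℤ (Set.range r)).mkQ v = h := fun h =>
    Submodule.mkQ_surjective _ _
  choose s hs using hlift
  have hrel : ∀ p : H × H, ∃ ξ, s p.1 + s p.2 - s (p.1 + p.2) ∈
      Submodule.span ℤ (r '' {t | x t < ξ}) := by
    intro p
    refine exists_mem_span_bounded r x ?_
    refine (Submodule.Quotient.mk_eq_zero _).1 ?_
    rw [← Submodule.mkQ_apply, map_sub, map_add, hs, hs, hs]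
    simp
  choose ξ hξ using hrel
  have hcard : #(H × H) < #L := by
    rw [← Cardinal.mul_def]; exact Cardinal.mul_lt_of_lt RegularOrder.aleph0_le hH hH
  obtain ⟨y, hy⟩ := RegularOrder.exists_bound_range ξ hcard
  have hfree := h4 (Classical.arbitrary K) y {t | x t < y} fun t ht => Or.inr ht
  let f : H →+ (F ⧸ Submodule.span ℤ (r '' {t | x t < y})) :=
    AddMonoidHom.mk' (fun h => Submodule.mkQ _ (s h)) fun a b => by
      rw [← map_add, eq_comm, ← sub_eq_zero, ← map_sub, ← LinearMap.mem_ker, Submodule.ker_mkQ]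
      refine Submodule.span_mono ?_ (hξ (a, b))
      exact Set.image_mono fun t (ht : x t < ξ (a, b)) => ht.trans (hy _)
  refine free_of_injective f.toIntLinearMap ?_
  refine (injective_iff_map_eq_zero f).2 fun h hh => ?_
  have h6 : s h ∈ Submodule.span ℤ (r '' {t | x t < y}) := by
    rw [← Submodule.ker_mkQ (Submodule.span ℤ (r '' {t | x t < y})), LinearMap.mem_ker]
    exact hh
  have h7 : s h ∈ Submodule.span ℤ (Set.range r) :=
    Submodule.span_mono (Set.image_subset_range _ _) h6
  rw [← Submodule.ker_mkQ (Submodule.span ℤ (Set.range r)), LinearMap.mem_ker, hs] at h7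
  exact Subtype.ext h7

theorem hasSys_nat : HasSys ℕ ℕ := by
  classical
  let e : Module.Basis ℕ ℤ (ℕ →₀ ℤ) := Finsupp.basisSingleOne
  have he : ∀ n, e n = Finsupp.single n 1 := fun n => by simp [e]
  let r : ℕ → (ℕ →₀ ℤ) := fun n => e n - (2 : ℤ) • e (n + 1)
  have hr : ∀ n, r n = e n - (2 : ℤ) • e (n + 1) := fun n => rfl
  have hcoord : ∀ j i, (r j) i = (if j = i then 1 else 0) - 2 * (if j + 1 = i then 1 else 0) := by
    intro j i
    simp [hr, he, Finsupp.single_apply]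
  refine ⟨ℕ, ℕ →₀ ℤ, inferInstance, r, id, id, ?_, le_rfl, by simp, ?_, ?_⟩
  · rw [linearIndependent_iff']
    intro s g hg
    by_contra! hcon
    obtain ⟨i1, hi1, hgi1⟩ := hcon
    have hex : ∃ i, i ∈ s ∧ g i ≠ 0 := ⟨i1, hi1, hgi1⟩
    have h0 := DFunLike.congr_fun hg (Nat.find hex)
    have hfind := Nat.find_spec hex
    rw [Finsupp.finsetSum_apply, Finset.sum_eq_single (Nat.find hex)] at h0
    · simp [hcoord] at h0
      exact hfind.2 h0
    · intro j hj hne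
      by_cases hgj : g j = 0
      · simp [hgj]
      · have h1 := Nat.find_min' hex ⟨hj, hgj⟩
        rw [Finsupp.smul_apply, hcoord, if_neg hne, if_neg (by omega)]
        simp
    · exact fun h => absurd hfind.1 h
  · intro i₀ x₀ B hB
    let N : (ℕ →₀ ℤ) →ₗ[ℤ] (ℕ →₀ ℤ) :=
      e.constr ℤ fun n => if n ∈ B then (2 : ℤ) • e (n + 1) else 0
    have hN : ∀ n, N (e n) = if n ∈ B then (2 : ℤ) • e (n + 1) else 0 :=
      fun n => e.constr_basis ℤ _ n
    refine free_quotient_of_rank_lt e (fun n => max i₀ x₀ - n) N ?_ B _ ?_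
    · intro n
      rw [hN]
      split_ifs with h
      · refine Submodule.smul_mem _ _ (Submodule.subset_span ⟨n + 1, ?_, rfl⟩)
        have := hB n h
        simp only [id, Set.mem_ofPred_eq] at this ⊢
        omega
      · exact Submodule.zero_mem _
    · congr 1
      refine Set.image_congr fun n hn => ?_
      rw [hN, if_pos hn]
  · intro hfree
    obtain ⟨⟨I, b⟩⟩ := hfree.exists_basis
    let W := Submodule.span ℤ (Set.range r)
    have hstep : ∀ n, W.mkQ (e n) = (2 : ℤ) • W.mkQ (e (n + 1)) := by
      intro n
      rw [← map_smul, ← sub_eq_zero, ← map_sub, ← LinearMap.mem_ker, Submodule.ker_mkQ]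
      exact Submodule.subset_span ⟨n, rfl⟩
    have hpow : ∀ n, W.mkQ (e 0) = (2 ^ n : ℤ) • W.mkQ (e n) := by
      intro n
      induction n with
      | zero => simp
      | succ n ih => rw [ih, hstep n, smul_smul, pow_succ]
    have hzero : W.mkQ (e 0) = 0 := by
      refine b.ext_elem fun j => ?_
      rw [b.repr.map_zero, Finsupp.zero_apply]
      set c := b.repr (W.mkQ (e 0)) j with hc
      have hdvd : (2 : ℤ) ^ c.natAbs ∣ c := by
        refine ⟨b.repr (W.mkQ (e c.natAbs)) j, ?_⟩
        have := congrArg (fun v => b.repr v j) (hpow c.natAbs)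
        simpa [hc] using this
      refine Int.eq_zero_of_abs_lt_dvd hdvd ?_
      rw [Int.abs_eq_natAbs]
      exact_mod_cast Nat.lt_two_pow_self
    let ψ : (ℕ →₀ ℤ) →ₗ[ℤ] ℚ := e.constr ℤ fun n => (1 / 2) ^ n
    have hψ : ∀ n, ψ (e n) = (1 / 2) ^ n := fun n => e.constr_basis ℤ _ n
    have hW : W ≤ LinearMap.ker ψ := by
      rw [Submodule.span_le]
      rintro _ ⟨n, rfl⟩
      rw [SetLike.mem_coe, LinearMap.mem_ker, hr, map_sub, map_smul, hψ, hψ, pow_succ]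
      simp only [zsmul_eq_mul]
      push_cast
      ring
    rw [← LinearMap.mem_ker, Submodule.ker_mkQ] at hzero
    have := hW hzero
    rw [LinearMap.mem_ker, hψ] at this
    simp at this

theorem mk_finsupp_le_max (α β : Type) [Zero β] : #(α →₀ β) ≤ max ℵ₀ (max #α #β) := by
  classical
  calc #(α →₀ β) ≤ #(Finset (α × β)) := Cardinal.mk_le_of_injective (Finsupp.graph_injective α β)
    _ ≤ #(List (α × β)) := Cardinal.mk_le_of_surjective List.toFinset_surjective
    _ ≤ max ℵ₀ #(α × β) := Cardinal.mk_list_le_max _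
    _ ≤ max ℵ₀ (max #α #β) := by
      rw [← Cardinal.mul_def]
      refine max_le (le_max_left _ _) ((Cardinal.mul_le_max _ _).trans ?_)
      exact max_le (le_max_right _ _) (le_max_left _ _)

/-- Choice-based recursion along a well-order. -/
theorem exists_wf_rec {W X : Type*} [LinearOrder W] [WellFoundedLT W]
    (P : ∀ ζ : W, (Set.Iio ζ → X) → X → Prop) (h : ∀ ζ f, ∃ y, P ζ f y) :
    ∃ a : W → X, ∀ ζ, P ζ (fun ζ' => a ζ') (a ζ) := by
  choose y hy using h
  let a : W → X := (wellFounded_lt (α := W)).fix fun ζ ih => y ζ fun ζ' => ih ζ' ζ'.2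
  refine ⟨a, fun ζ => ?_⟩
  have : a ζ = y ζ fun ζ' => a ζ' := (wellFounded_lt (α := W)).fix_eq _ ζ
  rw [this]
  exact hy _ _

namespace RegularOrder

variable {X : Type} [LinearOrder X] [RegularOrder X]

theorem exists_isLUB (s : Set X) (hs : #s < #X) : ∃ δ, IsLUB s δ := by
  obtain ⟨y, hy⟩ := exists_bound s hs
  obtain ⟨δ, h1, h2⟩ := (wellFounded_lt (α := X)).has_min (upperBounds s) ⟨y, fun x hx => (hy x hx).le⟩
  exact ⟨δ, h1, fun z hz => not_lt.1 (h2 z hz)⟩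

theorem exists_isLUB_range {ι : Type} (f : ι → X) (h : #ι < #X) : ∃ δ, IsLUB (Set.range f) δ :=
  exists_isLUB _ (Cardinal.mk_range_le.trans_lt h)

end RegularOrder

/-- `a δ` is an increasing sequence of length `Th` converging to `δ`, for every `δ : L` for which
such a sequence exists; `S` is the set of these `δ`. -/
structure IsLadderSystem {Th L : Type} [LinearOrder Th] [LinearOrder L] (S : Set L)
    (a : L → Th → L) : Prop where
  strictMono : ∀ δ ∈ S, StrictMono (a δ)
  isLUB : ∀ δ ∈ S, IsLUB (Set.range (a δ)) δ
  mem : ∀ δ (b : Th → L), StrictMono b → IsLUB (Set.range b) δ → δ ∈ S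

theorem exists_isLadderSystem (Th L : Type) [LinearOrder Th] [LinearOrder L] :
    ∃ (S : Set L) (a : L → Th → L), IsLadderSystem S a := by
  classical
  let S : Set L := {δ | ∃ b : Th → L, StrictMono b ∧ IsLUB (Set.range b) δ}
  refine ⟨S, fun δ => if h : δ ∈ S then h.choose else fun _ => δ, ?_, ?_, fun δ b h1 h2 => ⟨b, h1, h2⟩⟩
  · intro δ hδ
    rw [dif_pos hδ]
    exact hδ.choose_spec.1
  · intro δ hδ
    rw [dif_pos hδ]
    exact hδ.choose_spec.2

theorem IsLadderSystem.lt {Th L : Type} [LinearOrder Th] [NoMaxOrder Th] [LinearOrder L] {S : Set L}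
    {a : L → Th → L} (h : IsLadderSystem S a) {δ : L} (hδ : δ ∈ S) (ξ : Th) : a δ ξ < δ := by
  obtain ⟨ξ', hξ⟩ := exists_gt ξ
  exact (h.strictMono δ hδ hξ).trans_le ((h.isLUB δ hδ).1 ⟨ξ', rfl⟩)

/-- `D` has an enumeration along which each ladder is almost disjoint from the previous ones, in the
sense of the two-dimensional ideal of bounded subsets of `K × Th`. -/
def GoodOrder {K Th L U : Type} [LinearOrder K] [LinearOrder Th] (φ : L → K → U)
    (a : L → Th → L) (D : Set L) : Prop :=
  ∃ g : L → Ordinal.{0}, Set.InjOn g D ∧ ∀ δ ∈ D, ∃ i₀ ξ₀, ∀ δ' ∈ D, g δ' < g δ →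
    ∀ i ξ, φ δ' i = φ δ i → a δ' ξ = a δ ξ → i < i₀ ∨ ξ < ξ₀

theorem linearIndependent_gluedRel {D T Z F : Type} [AddCommGroup F] (r : T → F)
    (hr : LinearIndependent ℤ r) (χ : D → T → Z) : LinearIndependent ℤ (gluedRel r χ) := by
  refine LinearIndependent.of_comp (LinearMap.fst ℤ (D →₀ F) (Z →₀ ℤ)) ?_
  have h := Finsupp.linearIndependent_single (ι := D) (R := ℤ) (fun _ => r) fun _ => hr
  exact h.comp (fun p : D × T => ⟨p.1, p.2⟩) fun p q hpq => by
    simpa [Prod.ext_iff] using hpq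

theorem free_glued {K Th L U T F : Type} [LinearOrder K] [LinearOrder Th] [LinearOrder L]
    [WellFoundedLT L] [Nonempty Th] [AddCommGroup F] (r : T → F) (i : T → K) (x : T → Th)
    (hr : LinearIndependent ℤ r)
    (hfree : ∀ i₀ x₀ (B : Set T), (∀ t ∈ B, i t < i₀ ∨ x t < x₀) →
      Module.Free ℤ (F ⧸ Submodule.span ℤ (r '' B)))
    (φ : L → K → U) (a : L → Th → L) (S : Set L) (i₀ : K) (β : L)
    (hgood : GoodOrder φ a (S ∩ Set.Iio β)) (B : Set (S × T))
    (hB : ∀ p ∈ B, i p.2 < i₀ ∨ p.1 < β) :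
    Module.Free ℤ (((S →₀ F) × (U × L × T →₀ ℤ)) ⧸ Submodule.span ℤ
      (gluedRel r (fun (δ : S) t => (φ δ (i t), a δ (x t), t)) '' B)) := by
  classical
  obtain ⟨g, hg, hgd⟩ := hgood
  obtain ⟨Γ, hΓ⟩ : BddAbove (Set.range g) := Ordinal.bddAbove_of_small
  have hΓ' : ∀ δ, g δ ≤ Γ := fun δ => hΓ ⟨δ, rfl⟩
  let G : S → Ordinal.{0} := fun δ =>
    if (δ : L) < β then g δ else Γ + 1 + Ordinal.typein (α := L) (· < ·) δ
  have hG1 : ∀ δ : S, (δ : L) < β → G δ = g δ := fun δ h => if_pos h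
  have hG2 : ∀ δ : S, ¬ (δ : L) < β → G δ = Γ + 1 + Ordinal.typein (α := L) (· < ·) δ :=
    fun δ h => if_neg h
  have hlt : ∀ δ δ' : S, (δ : L) < β → ¬ (δ' : L) < β → G δ < G δ' := by
    intro δ δ' h h'
    rw [hG1 δ h, hG2 δ' h']
    calc g δ ≤ Γ := hΓ' _
      _ < Γ + 1 := lt_add_one _
      _ ≤ _ := le_self_add
  refine free_quotient_gluedRel G ?_ r hr _ ?_ B ?_
  · intro δ δ' h
    by_cases h1 : (δ : L) < β <;> by_cases h2 : (δ' : L) < β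
    · rw [hG1 δ h1, hG1 δ' h2] at h
      exact Subtype.ext (hg ⟨δ.2, h1⟩ ⟨δ'.2, h2⟩ h)
    · exact absurd h (hlt _ _ h1 h2).ne
    · exact absurd h (hlt _ _ h2 h1).ne'
    · rw [hG2 δ h1, hG2 δ' h2] at h
      exact Subtype.ext (Ordinal.typein_injective _ (add_left_cancel h))
  · intro δ t δ' t' h
    simp only [Prod.mk.injEq] at h
    exact h.2.2
  · intro δ
    by_cases h1 : (δ : L) < β
    · obtain ⟨i₁, ξ₁, h⟩ := hgd δ ⟨δ.2, h1⟩
      refine hfree i₁ ξ₁ _ ?_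
      rintro t ⟨_, δ', h2, h3, h4⟩
      have h5 : (δ' : L) < β := by
        by_contra h6
        exact lt_asymm h2 (hlt _ _ h1 h6)
      rw [hG1 _ h5, hG1 _ h1] at h2
      simp only [Prod.mk.injEq] at h4
      exact h δ' ⟨δ'.2, h5⟩ h2 _ _ h4.1 h4.2.1
    · refine hfree i₀ (Classical.arbitrary Th) _ ?_
      rintro t ⟨h2, -⟩
      exact Or.inl ((hB _ h2).resolve_right h1)

theorem not_free_glued {K Th L U T F : Type} [LinearOrder Th] [LinearOrder L]
    [RegularOrder Th] [RegularOrder L] (hTh : #Th < #L) (hU : #U < #L) (hT : #T ≤ #Th)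
    (hF : #F ≤ #Th) [AddCommGroup F] (r : T → F) (i : T → K) (x : T → Th)
    (hr : ¬ Module.Free ℤ (F ⧸ Submodule.span ℤ (Set.range r)))
    (φ : L → K → U) (a : L → Th → L) (S : Set L) (ha : IsLadderSystem S a) :
    ¬ Module.Free ℤ (((S →₀ F) × (U × L × T →₀ ℤ)) ⧸ Submodule.span ℤ
      (Set.range (gluedRel r (fun (δ : S) t => (φ δ (i t), a δ (x t), t))))) := by
  classical
  intro hfree
  have hL0 : ℵ₀ < #L := RegularOrder.aleph0_le.trans_lt hTh
  set ρ := gluedRel r (fun (δ : S) t => (φ δ (i t), a δ (x t), t)) with hρ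
  set W := Submodule.span ℤ (Set.range ρ) with hW
  obtain ⟨⟨I, b⟩⟩ := hfree.exists_basis
  let E : L → Set ((S →₀ F) × (U × L × T →₀ ℤ)) := fun β =>
    {v | (∀ δ ∈ v.1.support, (δ : L) < β) ∧ ∀ z ∈ v.2.support, z.2.1 < β}
  have hEmono : ∀ β β', β ≤ β' → E β ⊆ E β' := fun β β' h v hv =>
    ⟨fun δ hδ => (hv.1 δ hδ).trans_le h, fun z hz => (hv.2 z hz).trans_le h⟩
  have hEbound : ∀ v, ∃ β, v ∈ E β := by
    intro v
    let s : Finset L := v.1.support.image (fun δ : S => (δ : L)) ∪ v.2.support.image fun z => z.2.1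
    obtain ⟨β, hβ⟩ := RegularOrder.exists_bound (s : Set L)
      ((Cardinal.lt_aleph0_iff_finite.2 (Finset.finite_toSet s)).trans hL0)
    refine ⟨β, fun δ hδ => hβ _ ?_, fun z hz => hβ _ ?_⟩
    · simp only [s, Finset.mem_coe, Finset.mem_union, Finset.mem_image]
      exact Or.inl ⟨δ, hδ, rfl⟩
    · simp only [s, Finset.mem_coe, Finset.mem_union, Finset.mem_image]
      exact Or.inr ⟨z, hz, rfl⟩
  have hEcard : ∀ β, #(E β) < #L := by
    intro β
    let f : ({δ : S // (δ : L) < β} →₀ F) × ({z : U × L × T // z.2.1 < β} →₀ ℤ) →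
        (S →₀ F) × (U × L × T →₀ ℤ) := fun p =>
      (p.1.embDomain (Function.Embedding.subtype _), p.2.embDomain (Function.Embedding.subtype _))
    have hsub : E β ⊆ Set.range f := by
      intro v hv
      refine ⟨(v.1.comapDomain Subtype.val Subtype.val_injective.injOn,
        v.2.comapDomain Subtype.val Subtype.val_injective.injOn), ?_⟩
      refine Prod.ext ?_ ?_
      · refine Finsupp.embDomain_comapDomain (f := Function.Embedding.subtype _) ?_
        intro δ hδ
        exact ⟨⟨δ, hv.1 δ hδ⟩, rfl⟩
      · refine Finsupp.embDomain_comapDomain (f := Function.Embedding.subtype _) ?_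
        intro δ hδ
        exact ⟨⟨δ, hv.2 δ hδ⟩, rfl⟩
    refine (Cardinal.mk_le_mk_of_subset hsub).trans_lt (Cardinal.mk_range_le.trans_lt ?_)
    have h1 : #{δ : S // (δ : L) < β} < #L := by
      refine lt_of_le_of_lt ?_ (RegularOrder.mk_Iio_lt β)
      exact Cardinal.mk_le_of_injective (f := fun δ => (⟨δ.1, δ.2⟩ : Set.Iio β))
        fun δ δ' h => by simpa [Subtype.ext_iff] using h
    have h2 : #{z : U × L × T // z.2.1 < β} < #L := by
      refine lt_of_le_of_lt (b := #(U × Set.Iio β × T)) ?_ ?_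
      · exact Cardinal.mk_le_of_injective
          (f := fun z => ((z.1.1, ⟨z.1.2.1, z.2⟩, z.1.2.2) : U × Set.Iio β × T))
          fun δ δ' h => by simpa [Subtype.ext_iff, Prod.ext_iff] using h
      · rw [Cardinal.mk_prod, Cardinal.mk_prod]
        simp only [Cardinal.lift_id]
        exact Cardinal.mul_lt_of_lt hL0.le hU (Cardinal.mul_lt_of_lt hL0.le
          (RegularOrder.mk_Iio_lt β) (hT.trans_lt hTh))
    rw [Cardinal.mk_prod]
    simp only [Cardinal.lift_id]
    refine Cardinal.mul_lt_of_lt hL0.le ?_ ?_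
    · exact (mk_finsupp_le_max _ _).trans_lt (max_lt hL0 (max_lt h1 (hF.trans_lt hTh)))
    · exact (mk_finsupp_le_max _ _).trans_lt (max_lt hL0 (max_lt h2 (by simpa using hL0)))
  choose s hs using fun c : I => W.mkQ_surjective (b c)
  choose e he using hEbound
  have hclose : ∀ β, ∃ β', β < β' ∧ ∀ v ∈ E β, ∀ c ∈ (b.repr (W.mkQ v)).support, s c ∈ E β' := by
    intro β
    obtain ⟨y, hy⟩ := RegularOrder.exists_bound_range
      (fun p : Σ v : E β, (b.repr (W.mkQ v)).support => e (s p.2)) (by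
        rw [Cardinal.mk_sigma]
        refine (Cardinal.sum_le_sum _ (fun _ => ℵ₀) fun v => ?_).trans_lt ?_
        · exact Cardinal.mk_le_aleph0
        · rw [Cardinal.sum_const']
          exact Cardinal.mul_lt_of_lt hL0.le (hEcard β) hL0)
    obtain ⟨β', hβ'⟩ := exists_gt (max y β)
    refine ⟨β', (le_max_right _ _).trans_lt hβ', fun v hv c hc => ?_⟩
    exact hEmono _ _ ((hy ⟨⟨v, hv⟩, ⟨c, hc⟩⟩).le.trans ((le_max_left _ _).trans hβ'.le)) (he _)
  choose h hh1 hh2 using hclose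
  obtain ⟨A, hA⟩ := exists_wf_rec (W := Th) (X := L) (fun ζ f y => ∀ ζ', h (f ζ') < y) fun ζ f => by
    refine RegularOrder.exists_bound_range (fun ζ' => h (f ζ')) ?_
    exact (RegularOrder.mk_Iio_lt ζ).trans hTh
  have hA' : ∀ ζ' ζ, ζ' < ζ → h (A ζ') < A ζ := fun ζ' ζ hζ => hA ζ ⟨ζ', hζ⟩
  have hAmono : StrictMono A := fun ζ' ζ hζ => (hh1 _).trans (hA' _ _ hζ)
  obtain ⟨δ, hδ⟩ := RegularOrder.exists_isLUB_range A hTh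
  have hδS : δ ∈ S := ha.mem δ A hAmono hδ
  have hlub : ∀ β < δ, ∃ ζ, β ≤ A ζ := by
    intro β hβ
    by_contra! hcon
    refine absurd (hδ.2 (?_ : β ∈ _)) (not_le.2 hβ)
    rintro _ ⟨ζ, rfl⟩
    exact (hcon ζ).le
  have := RegularOrder.nonempty' Th
  have hEδ : ∀ v ∈ E δ, ∃ ζ, v ∈ E (A ζ) := by
    intro v hv
    choose! ζ hζ using hlub
    let q : Finset Th := v.1.support.image (fun δ : S => ζ δ) ∪ v.2.support.image fun z => ζ z.2.1
    obtain ⟨ζ₀, hζ₀⟩ := RegularOrder.exists_bound (q : Set Th)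
      ((Cardinal.lt_aleph0_iff_finite.2 (Finset.finite_toSet q)).trans_le RegularOrder.aleph0_le)
    refine ⟨ζ₀, fun d hd => ?_, fun z hz => ?_⟩
    · refine (hζ _ (hv.1 d hd)).trans_lt (hAmono (hζ₀ _ ?_))
      simp only [q, Finset.mem_coe, Finset.mem_union, Finset.mem_image]
      exact Or.inl ⟨d, hd, rfl⟩
    · refine (hζ _ (hv.2 z hz)).trans_lt (hAmono (hζ₀ _ ?_))
      simp only [q, Finset.mem_coe, Finset.mem_union, Finset.mem_image]
      exact Or.inr ⟨z, hz, rfl⟩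
  have hcl : ∀ v ∈ E δ, ∀ c ∈ (b.repr (W.mkQ v)).support, s c ∈ E δ := by
    intro v hv c hc
    obtain ⟨ζ, hζ⟩ := hEδ v hv
    obtain ⟨ζ', hζ'⟩ := exists_gt ζ
    exact hEmono _ _ ((hA' _ _ hζ').le.trans (hδ.1 ⟨ζ', rfl⟩)) (hh2 _ v hζ c hc)
  let I₀ : Set I := {c | s c ∈ E δ}
  have hquot := free_quotient_span_basis b I₀
  set Y := Submodule.span ℤ (b '' I₀) with hY
  have hEY : ∀ v ∈ E δ, W.mkQ v ∈ Y := by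
    intro v hv
    rw [hY, Module.Basis.mem_span_image]
    exact fun c hc => hcl v hv c hc
  let d : S := ⟨δ, hδS⟩
  let j : F →ₗ[ℤ] _ := Y.mkQ.comp (W.mkQ.comp
    ((LinearMap.inl ℤ (S →₀ F) (U × L × T →₀ ℤ)).comp (Finsupp.lsingle d)))
  let q : (S →₀ F) × (U × L × T →₀ ℤ) →ₗ[ℤ] F ⧸ Submodule.span ℤ (Set.range r) :=
    (Submodule.mkQ _).comp ((Finsupp.lapply d).comp (LinearMap.fst ℤ _ _))
  have hq : ∀ v, q v = Submodule.mkQ _ (v.1 d) := fun v => rfl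
  have hqW : W ≤ LinearMap.ker q := by
    rw [hW, Submodule.span_le]
    rintro _ ⟨⟨δ', t⟩, rfl⟩
    rw [SetLike.mem_coe, LinearMap.mem_ker, hq]
    simp only [hρ, gluedRel, Finsupp.single_apply]
    split_ifs
    · exact (Submodule.Quotient.mk_eq_zero _).2 (Submodule.subset_span ⟨t, rfl⟩)
    · exact map_zero _
  have hYq : Y ≤ LinearMap.ker (W.liftQ q hqW) := by
    rw [hY, Submodule.span_le]
    rintro _ ⟨c, hc, rfl⟩
    have hd : (s c).1 d = 0 := by
      by_contra hne
      exact lt_irrefl _ (hc.1 d (Finsupp.mem_support_iff.2 hne))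
    rw [SetLike.mem_coe, LinearMap.mem_ker, ← hs, Submodule.mkQ_apply, Submodule.liftQ_apply, hq,
      hd, map_zero]
  have hker : LinearMap.ker j = Submodule.span ℤ (Set.range r) := by
    apply le_antisymm
    · intro v hv
      have h1 : W.mkQ (Finsupp.single d v, 0) ∈ Y := (Submodule.Quotient.mk_eq_zero _).1 hv
      have h2 := hYq h1
      rw [LinearMap.mem_ker, Submodule.mkQ_apply, Submodule.liftQ_apply, hq] at h2
      simpa using h2
    · rw [Submodule.span_le]
      rintro _ ⟨t, rfl⟩
      refine (Submodule.Quotient.mk_eq_zero _).2 ?_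
      have h1 : W.mkQ (Finsupp.single d (r t), 0) =
          W.mkQ (0, Finsupp.single (φ δ (i t), a δ (x t), t) 1) := by
        rw [← sub_eq_zero, ← map_sub]
        refine (Submodule.Quotient.mk_eq_zero _).2 (Submodule.subset_span ⟨(d, t), ?_⟩)
        simp [hρ, gluedRel, d]
      refine (congrArg (· ∈ Y) h1).mpr (hEY _ ⟨by simp, fun z hz => ?_⟩)
      have hz' := Finsupp.support_single_subset hz
      rw [Finset.mem_singleton] at hz'
      rw [hz']
      exact ha.lt hδS _
  exact hr (hker ▸ free_quotient_ker j)

theorem HasSys.attach {K Th L U : Type} [LinearOrder K] [LinearOrder Th] [LinearOrder L]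
    [RegularOrder Th] [RegularOrder L] (hTh : #Th < #L) (hU : #U < #L) (hsys : HasSys K Th)
    (φ : L → K → U) (a : L → Th → L) (S : Set L) (ha : IsLadderSystem S a)
    (hgood : ∀ β, GoodOrder φ a (S ∩ Set.Iio β)) : HasSys K L := by
  obtain ⟨T, F, _, r, i, x, hr, hT, hF, hfree, hnf⟩ := hsys
  have := RegularOrder.nonempty' Th
  have hL0 : ℵ₀ ≤ #L := RegularOrder.aleph0_le
  have hS : #S ≤ #L := Cardinal.mk_set_le _
  refine ⟨S × T, (S →₀ F) × (U × L × T →₀ ℤ), inferInstance,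
    gluedRel r (fun (δ : S) t => (φ δ (i t), a δ (x t), t)), fun p => i p.2, fun p => p.1,
    linearIndependent_gluedRel r hr _, ?_, ?_, ?_, not_free_glued hTh hU hT hF r i x hnf φ a S ha⟩
  · rw [← Cardinal.mul_def]
    exact Cardinal.mul_le_of_le hL0 hS (hT.trans hTh.le)
  · rw [← Cardinal.mul_def]
    refine Cardinal.mul_le_of_le hL0 ?_ ?_
    · exact (mk_finsupp_le_max _ _).trans (max_le hL0 (max_le hS (hF.trans hTh.le)))
    · refine (mk_finsupp_le_max _ _).trans (max_le hL0 (max_le ?_ (by simpa using hL0)))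
      rw [← Cardinal.mul_def, ← Cardinal.mul_def]
      exact Cardinal.mul_le_of_le hL0 hU.le (Cardinal.mul_le_of_le hL0 le_rfl (hT.trans hTh.le))
  · intro i₀ β B hB
    exact free_glued r i x hr hfree φ a S i₀ β (hgood β) B hB

namespace IsLadderSystem

variable {Th L : Type} [LinearOrder Th] [LinearOrder L] {S : Set L}
  {a : L → Th → L}

theorem exists_le (ha : IsLadderSystem S a) {δ γ : L} (hδ : δ ∈ S) (h : γ < δ) :
    ∃ ξ, γ ≤ a δ ξ := by
  by_contra! hcon
  refine absurd ((ha.isLUB δ hδ).2 (?_ : γ ∈ _)) (not_le.2 h)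
  rintro _ ⟨ζ, rfl⟩
  exact (hcon ζ).le

variable [RegularOrder Th]

theorem exists_ne (ha : IsLadderSystem S a) {δ δ' : L} (hδ : δ ∈ S) (hδ' : δ' ∈ S) (h : δ' ≠ δ) :
    ∃ ξ₀, ∀ ξ, a δ' ξ = a δ ξ → ξ < ξ₀ := by
  rcases lt_or_gt_of_ne h with h | h
  · obtain ⟨ξ₀, hξ₀⟩ := ha.exists_le hδ h
    refine ⟨ξ₀, fun ξ hξ => not_le.1 fun hle => ?_⟩
    have h1 := (ha.strictMono δ hδ).monotone hle
    exact absurd (ha.lt hδ' ξ) (not_lt.2 (hξ ▸ hξ₀.trans h1))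
  · obtain ⟨ξ₀, hξ₀⟩ := ha.exists_le hδ' h
    refine ⟨ξ₀, fun ξ hξ => not_le.1 fun hle => ?_⟩
    have h1 := (ha.strictMono δ' hδ').monotone hle
    exact absurd (ha.lt hδ ξ) (not_lt.2 (hξ ▸ hξ₀.trans h1))

theorem goodOrder_of_mk_le {K U : Type} [LinearOrder K] [Nonempty K] (ha : IsLadderSystem S a)
    (φ : L → K → U) {D : Set L} (hDS : D ⊆ S) (hD : #D ≤ #Th) : GoodOrder φ a D := by
  classical
  obtain ⟨e⟩ := hD
  let g : L → Ordinal.{0} := fun δ =>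
    if h : δ ∈ D then Ordinal.typein (α := Th) (· < ·) (e ⟨δ, h⟩) else 0
  have hg : ∀ δ (h : δ ∈ D), g δ = Ordinal.typein (α := Th) (· < ·) (e ⟨δ, h⟩) :=
    fun δ h => dif_pos h
  refine ⟨g, fun δ hδ δ' hδ' h => ?_, fun δ hδ => ?_⟩
  · rw [hg δ hδ, hg δ' hδ'] at h
    simpa using e.injective (Ordinal.typein_injective _ h)
  · let P := {δ' : D // e δ' < e ⟨δ, hδ⟩}
    have hP : #P < #Th := by
      refine lt_of_le_of_lt ?_ (RegularOrder.mk_Iio_lt (e ⟨δ, hδ⟩))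
      exact Cardinal.mk_le_of_injective (f := fun p : P => (⟨e p.1, p.2⟩ : Set.Iio (e ⟨δ, hδ⟩)))
        fun p q h => Subtype.ext (e.injective (congrArg Subtype.val h))
    have hne : ∀ p : P, ∃ ξ₀, ∀ ξ, a p.1 ξ = a δ ξ → ξ < ξ₀ := fun p =>
      ha.exists_ne (hDS hδ) (hDS p.1.2) fun h => by
        have h1 : p.1 = ⟨δ, hδ⟩ := Subtype.ext h
        exact absurd p.2 (by rw [h1]; exact lt_irrefl _)
    choose ξ₀ hξ₀ using hne
    obtain ⟨y, hy⟩ := RegularOrder.exists_bound_range ξ₀ hP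
    refine ⟨Classical.arbitrary K, y, fun δ' hδ' hlt i ξ _ h2 => Or.inr ?_⟩
    rw [hg δ' hδ', hg δ hδ, Ordinal.typein_lt_typein] at hlt
    exact (hξ₀ ⟨⟨δ', hδ'⟩, hlt⟩ ξ h2).trans (hy _)

end IsLadderSystem

theorem HasSys.succ {K Th L : Type} [LinearOrder K] [LinearOrder Th] [LinearOrder L] [Nonempty K]
    [RegularOrder Th] [RegularOrder L] (hL : #L = Order.succ #Th) (h : HasSys K Th) :
    HasSys K L := by
  have hlt : #Th < #L := hL ▸ Order.lt_succ _
  obtain ⟨S, a, ha⟩ := exists_isLadderSystem Th L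
  refine h.attach (U := Unit) hlt ?_ (fun _ _ => ()) a S ha fun β => ?_
  · exact (Cardinal.lt_aleph0_of_finite Unit).trans_le RegularOrder.aleph0_le
  · refine ha.goodOrder_of_mk_le _ Set.inter_subset_left ?_
    have h1 := RegularOrder.mk_Iio_lt β
    rw [hL, Order.lt_succ_iff] at h1
    exact (Cardinal.mk_le_mk_of_subset Set.inter_subset_right).trans h1

namespace RegularOrder

variable {X : Type} [LinearOrder X] [RegularOrder X]

theorem mk_le_cof (X : Type) [LinearOrder X] [RegularOrder X] : #X ≤ Order.cof X := by
  rw [Order.le_cof_iff]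
  intro s hs
  by_contra! hcon
  obtain ⟨y, hy⟩ := exists_bound s hcon
  obtain ⟨x, hx, hyx⟩ := hs y
  exact absurd (hy x hx) (not_lt.2 hyx)

theorem isClub_iInter {ι : Type} (hX : ℵ₀ < #X) (f : ι → Set X) (hι : #ι < #X)
    (hf : ∀ i, IsClub (f i)) : IsClub (⋂ i, f i) :=
  IsClub.iInter (hX.trans_le (mk_le_cof X)).ne' (by simpa using hι.trans_le (mk_le_cof X)) hf

theorem _root_.IsClub.exists_gt_mem {C : Set X} (hC : IsClub C) (x : X) : ∃ y ∈ C, x < y := by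
  obtain ⟨z, hz⟩ := exists_gt x
  obtain ⟨y, hy, hzy⟩ := hC.isCofinal z
  exact ⟨y, hy, hz.trans_le hzy⟩

theorem _root_.IsClub.exists_isGreatest {C : Set X} (hC : IsClub C) {x z : X} (hz : z ∈ C)
    (hzx : z ≤ x) : ∃ y, IsGreatest (C ∩ Set.Iic x) y := by
  have hcard : #↥(C ∩ Set.Iic x) < #X :=
    (Cardinal.mk_le_mk_of_subset Set.inter_subset_right).trans_lt (mk_Iic_lt x)
  obtain ⟨y, hy⟩ := exists_isLUB _ hcard
  exact ⟨y, ⟨hC.isLUB_mem Set.inter_subset_left ⟨z, hz, hzx⟩ hy, hy.2 fun w hw => hw.2⟩, hy.1⟩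

end RegularOrder

/-- The set of last elements of `E` below the points of the sequence `a`. -/
def lastPoints {W W₁ : Type} [LinearOrder W] (E : Set W) (a : W₁ → W) : Set W :=
  {y | ∃ ζ, IsGreatest (E ∩ Set.Iic (a ζ)) y}

/-- The club guessing principle for cofinality `#W₁` in `W`, when there is a regular cardinal
strictly between `#W₁` and `#W`. -/
theorem exists_club_guessing {W₁ V W : Type} [LinearOrder W₁] [LinearOrder V] [LinearOrder W]
    [RegularOrder W₁] [RegularOrder V] [RegularOrder W] (h₁ : #W₁ < #V) (h₂ : #V < #W) :
    ∃ c : W → Set W, ∀ C, IsClub C → ∃ γ, c γ ⊆ C ∧ (c γ).Nonempty ∧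
      ∀ s ⊆ c γ, #s < #W₁ → ∃ y ∈ c γ, ∀ x ∈ s, x < y := by
  obtain ⟨S, a, ha⟩ := exists_isLadderSystem W₁ W
  have hW : ℵ₀ < #W := RegularOrder.aleph0_le.trans_lt h₂
  have hV₁ := RegularOrder.nonempty' W₁
  have hVV := RegularOrder.nonempty' V
  have hWW := RegularOrder.nonempty' W
  by_contra! hcon
  choose C hC hCbad using fun E : Set W => hcon fun γ => lastPoints E (a γ)
  obtain ⟨E, hE⟩ := exists_wf_rec (W := V) (X := Set W)
    (fun n f y => y = ⋂ m, f m ∩ C (f m)) fun n f => ⟨_, rfl⟩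
  have hEclub : ∀ n, IsClub (E n) := by
    intro n
    induction n using WellFoundedLT.induction with
    | ind n ih =>
    rw [hE]
    exact RegularOrder.isClub_iInter hW _ ((RegularOrder.mk_Iio_lt n).trans h₂) fun m =>
      IsClub.inter (hW.trans_le (RegularOrder.mk_le_cof W)).ne' (ih m m.2) (hC _)
  have hEsub : ∀ m n, m < n → E n ⊆ E m ∩ C (E m) := by
    intro m n hmn
    conv_lhs => rw [hE]
    exact Set.iInter_subset (fun m : Set.Iio n => E m ∩ C (E m)) ⟨m, hmn⟩
  have hEanti : ∀ m n, m ≤ n → E n ⊆ E m := by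
    intro m n hmn
    rcases hmn.eq_or_lt with rfl | h
    · exact subset_rfl
    · exact (hEsub m n h).trans Set.inter_subset_left
  have hEinf : IsClub (⋂ n, E n) := RegularOrder.isClub_iInter hW E h₂ hEclub
  obtain ⟨b, hb⟩ := exists_wf_rec (W := W₁) (X := W)
    (fun ζ f y => y ∈ (⋂ n, E n) ∧ ∀ ζ', f ζ' < y) fun ζ f => by
    obtain ⟨x, hx⟩ := RegularOrder.exists_bound_range f
      ((RegularOrder.mk_Iio_lt ζ).trans (h₁.trans h₂))
    obtain ⟨y, hy, hxy⟩ := hEinf.exists_gt_mem x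
    exact ⟨y, hy, fun ζ' => (hx ζ').trans hxy⟩
  have hbmono : StrictMono b := fun ζ' ζ h => (hb ζ).2 ⟨ζ', h⟩
  have hbE : ∀ ζ n, b ζ ∈ E n := fun ζ n => Set.mem_iInter.1 (hb ζ).1 n
  obtain ⟨γ, hγ⟩ := RegularOrder.exists_isLUB_range b (h₁.trans h₂)
  have hγS : γ ∈ S := ha.mem γ b hbmono hγ
  have hblt : ∀ ζ, b ζ < γ := fun ζ => by
    obtain ⟨ζ', h⟩ := exists_gt ζ
    exact (hbmono h).trans_le (hγ.1 ⟨ζ', rfl⟩)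
  have hbcof : ∀ x < γ, ∃ ζ, x < b ζ := by
    intro x hx
    by_contra! h
    refine absurd (hγ.2 (?_ : x ∈ _)) (not_le.2 hx)
    rintro _ ⟨ζ, rfl⟩
    exact h ζ
  have hstab : ∀ ζ, ∃ n, ∀ m, n ≤ m → ∀ y, IsGreatest (E m ∩ Set.Iic (a γ ζ)) y ↔
      IsGreatest (E n ∩ Set.Iic (a γ ζ)) y := by
    intro ζ
    by_cases h : ∃ n, E n ∩ Set.Iic (a γ ζ) = ∅
    · obtain ⟨n, hn⟩ := h
      refine ⟨n, fun m hm y => ?_⟩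
      have hm' : E m ∩ Set.Iic (a γ ζ) = ∅ :=
        Set.subset_empty_iff.1 ((Set.inter_subset_inter_left _ (hEanti n m hm)).trans hn.subset)
      rw [hm', hn]
    · have hne : ∀ n, ∃ y, IsGreatest (E n ∩ Set.Iic (a γ ζ)) y := by
        intro n
        obtain ⟨z, hz1, hz2⟩ := Set.nonempty_iff_ne_empty.2 (not_exists.1 h n)
        exact (hEclub n).exists_isGreatest hz1 hz2
      choose y hy using hne
      have hanti : ∀ m n, m ≤ n → y n ≤ y m := fun m n hmn =>
        (hy m).2 ⟨hEanti m n hmn (hy n).1.1, (hy n).1.2⟩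
      obtain ⟨_, ⟨n, rfl⟩, hmin⟩ := (wellFounded_lt (α := W)).has_min (Set.range y)
        (Set.range_nonempty y)
      refine ⟨n, fun m hm z => ?_⟩
      have hmn : y m = y n := le_antisymm (hanti n m hm) (not_lt.1 (hmin _ ⟨m, rfl⟩))
      exact ⟨fun hz => by rw [hz.unique (hy m), hmn]; exact hy n,
        fun hz => by rw [hz.unique (hy n), ← hmn]; exact hy m⟩
  choose n hn using hstab
  obtain ⟨N, hN⟩ := RegularOrder.exists_bound_range n h₁
  have hlast : ∀ m, N ≤ m → lastPoints (E m) (a γ) = lastPoints (E N) (a γ) := by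
    intro m hm
    ext y
    exact exists_congr fun ζ => (hn ζ m ((hN ζ).le.trans hm) y).trans (hn ζ N (hN ζ).le y).symm
  have hex : ∀ x < γ, ∃ y ∈ lastPoints (E N) (a γ), x < y := by
    intro x hx
    obtain ⟨ζ, hζ⟩ := hbcof x hx
    obtain ⟨ζ', hζ'⟩ := ha.exists_le hγS (hblt ζ)
    obtain ⟨y, hy⟩ := (hEclub N).exists_isGreatest (hbE ζ N) hζ'
    exact ⟨y, ⟨ζ', hy⟩, hζ.trans_le (hy.2 ⟨hbE ζ N, hζ'⟩)⟩
  obtain ⟨ζ₀⟩ := hV₁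
  obtain ⟨s, hs, hscard, hsbad⟩ := hCbad (E N) γ (by
    obtain ⟨m, hm⟩ := exists_gt N
    rw [← hlast m hm.le]
    rintro y ⟨ζ, hy⟩
    exact (hEsub N m hm hy.1.1).2) (by
    obtain ⟨y, hy, -⟩ := hex _ (hblt ζ₀)
    exact ⟨y, hy⟩)
  choose ζ hζ using fun x : s => hs x.2
  obtain ⟨ζ₁, hζ₁⟩ := RegularOrder.exists_bound_range ζ hscard
  obtain ⟨y, hy, hlt⟩ := hex _ (ha.lt hγS ζ₁)
  obtain ⟨x, hx, hyx⟩ := hsbad y hy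
  have h3 : x ≤ a γ (ζ ⟨x, hx⟩) := (hζ ⟨x, hx⟩).1.2
  have h4 := ha.strictMono γ hγS (hζ₁ ⟨x, hx⟩)
  exact absurd (h3.trans_lt (h4.trans hlt)) (not_lt.2 hyx)

/-- A strictly increasing map preserving suprema of nonempty sets. -/
structure IsContLadder {W L : Type} [LinearOrder W] [LinearOrder L] (ξ : W → L) : Prop where
  strictMono : StrictMono ξ
  isLUB_image : ∀ (s : Set W) ζ, s.Nonempty → IsLUB s ζ → IsLUB (ξ '' s) (ξ ζ)

theorem exists_lt_of_isLUB_range {W L : Type} [LinearOrder W] [NoMaxOrder W] [LinearOrder L]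
    {ξ η : W → L} (hξ : StrictMono ξ) {γ : L} (hξγ : IsLUB (Set.range ξ) γ)
    (hηγ : IsLUB (Set.range η) γ) (ζ : W) : ∃ ζ', ξ ζ < η ζ' := by
  by_contra! h
  obtain ⟨ζ', h1⟩ := exists_gt ζ
  have h2 : γ ≤ ξ ζ := hηγ.2 (by rintro _ ⟨z, rfl⟩; exact h z)
  exact absurd ((hξ h1).trans_le (hξγ.1 ⟨ζ', rfl⟩)) (not_lt.2 h2)

theorem IsContLadder.isClub_eq {W L : Type} [LinearOrder W] [RegularOrder W] [LinearOrder L]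
    (hW : ℵ₀ < #W) {ξ η : W → L} (hξ : IsContLadder ξ) (hη : IsContLadder η) {γ : L}
    (hξγ : IsLUB (Set.range ξ) γ) (hηγ : IsLUB (Set.range η) γ) : IsClub {ζ | ξ ζ = η ζ} := by
  refine ⟨fun t ht ht0 _ ζ hζ => ?_, fun ζ₀ => ?_⟩
  · have h1 := hξ.isLUB_image t ζ ht0 hζ
    rw [Set.image_congr fun z hz => ht hz] at h1
    exact h1.unique (hη.isLUB_image t ζ ht0 hζ)
  · have hstep : ∀ ζ, ∃ ζ', ζ < ζ' ∧ ξ ζ < η ζ' ∧ η ζ < ξ ζ' := by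
      intro ζ
      obtain ⟨ζ₁, h1⟩ := exists_lt_of_isLUB_range hξ.strictMono hξγ hηγ ζ
      obtain ⟨ζ₂, h2⟩ := exists_lt_of_isLUB_range hη.strictMono hηγ hξγ ζ
      obtain ⟨ζ', h3⟩ := exists_gt (max ζ (max ζ₁ ζ₂))
      simp only [max_lt_iff] at h3
      exact ⟨ζ', h3.1, h1.trans (hη.strictMono h3.2.1), h2.trans (hξ.strictMono h3.2.2)⟩
    choose n hn1 hn2 hn3 using hstep
    let z : ℕ → W := fun k => n^[k] ζ₀
    have hz : ∀ k, z (k + 1) = n (z k) := fun k => Function.iterate_succ_apply' n k ζ₀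
    obtain ⟨ζ, hζ⟩ := RegularOrder.exists_isLUB_range z (by simpa using hW)
    refine ⟨ζ, le_antisymm ?_ ?_, hζ.1 ⟨0, rfl⟩⟩
    · refine (hξ.isLUB_image _ ζ (Set.range_nonempty z) hζ).2 ?_
      rintro _ ⟨_, ⟨k, rfl⟩, rfl⟩
      refine (hn2 _).le.trans (hη.strictMono.monotone (hζ.1 ⟨k + 1, hz k⟩))
    · refine (hη.isLUB_image _ ζ (Set.range_nonempty z) hζ).2 ?_
      rintro _ ⟨_, ⟨k, rfl⟩, rfl⟩
      refine (hn3 _).le.trans (hξ.strictMono.monotone (hζ.1 ⟨k + 1, hz k⟩))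

/-- A sequence of functions increasing modulo bounded sets, continuous along clubs at points of
cofinality `#W`. -/
structure IsScale {K W L : Type} {V : K → Type} [LinearOrder K] [LinearOrder W] [LinearOrder L]
    [∀ i, LinearOrder (V i)] (f : L → ∀ i, V i) : Prop where
  eventually_lt : ∀ α γ, α < γ → ∃ i₀, ∀ i, i₀ ≤ i → f α i < f γ i
  exists_club : ∀ ξ : W → L, IsContLadder ξ → ∀ γ, IsLUB (Set.range ξ) γ →
    ∃ C, IsClub C ∧ ∀ ζ ∈ C, ∀ i, f (ξ ζ) i < f γ i

theorem exists_isScale {K W L : Type} (V : K → Type) [LinearOrder K] [LinearOrder W] [LinearOrder L]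
    [∀ i, LinearOrder (V i)] [RegularOrder W] [RegularOrder L] [∀ i, RegularOrder (V i)]
    (hW : ℵ₀ < #W) (hV : ∀ i, #W < #(V i)) (m : L → L → K)
    (hm : ∀ γ i, #{α | α < γ ∧ m γ α ≤ i} < #(V i)) :
    ∃ f : L → ∀ i, V i, IsScale (W := W) f := by
  classical
  let e : L → W → L := fun γ =>
    if h : ∃ ξ : W → L, IsContLadder ξ ∧ IsLUB (Set.range ξ) γ then h.choose else fun _ => γ
  obtain ⟨f, hf⟩ := exists_wf_rec (W := L) (X := ∀ i, V i)
    (fun γ F y => ∀ i, (∀ α : Set.Iio γ, m γ α ≤ i → F α i < y i) ∧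
      ∀ α : Set.Iio γ, (∃ ζ, e γ ζ = α) → F α i < y i) fun γ F => by
    have h1 : ∀ i, ∃ y : V i, (∀ α : Set.Iio γ, m γ α ≤ i → F α i < y) ∧
        ∀ α : Set.Iio γ, (∃ ζ, e γ ζ = α) → F α i < y := by
      intro i
      obtain ⟨y₁, hy₁⟩ := RegularOrder.exists_bound_range
        (fun α : {α | α < γ ∧ m γ α ≤ i} => F ⟨α, α.2.1⟩ i) (hm γ i)
      obtain ⟨y₂, hy₂⟩ := RegularOrder.exists_bound
        ((fun α => F α i) '' {α : Set.Iio γ | ∃ ζ, e γ ζ = α}) (by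
          refine Cardinal.mk_image_le.trans_lt (lt_of_le_of_lt ?_ (hV i))
          refine Cardinal.mk_le_of_injective (f := fun α => α.2.choose) fun α β h => ?_
          refine Subtype.ext (Subtype.ext ?_)
          rw [← α.2.choose_spec, ← β.2.choose_spec]
          exact congrArg _ h)
      refine ⟨max y₁ y₂, fun α hα => lt_max_of_lt_left (hy₁ ⟨α, α.2, hα⟩),
        fun α hα => lt_max_of_lt_right (hy₂ _ ⟨α, hα, rfl⟩)⟩
    choose y hy using h1
    exact ⟨y, hy⟩
  refine ⟨f, fun α γ h => ⟨m γ α, fun i hi => (hf γ i).1 ⟨α, h⟩ hi⟩, fun ξ hξ γ hγ => ?_⟩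
  have hex : ∃ ξ : W → L, IsContLadder ξ ∧ IsLUB (Set.range ξ) γ := ⟨ξ, hξ, hγ⟩
  have he : e γ = hex.choose := dif_pos hex
  have he1 : IsContLadder (e γ) := he ▸ hex.choose_spec.1
  have he2 : IsLUB (Set.range (e γ)) γ := he ▸ hex.choose_spec.2
  refine ⟨_, hξ.isClub_eq hW he1 hγ he2, fun ζ hζ i => ?_⟩
  obtain ⟨ζ', hζ'⟩ := exists_gt ζ
  have hlt : ξ ζ < γ := (hξ.strictMono hζ').trans_le (hγ.1 ⟨ζ', rfl⟩)
  exact (hf γ i).2 ⟨ξ ζ, hlt⟩ ⟨ζ, hζ.symm⟩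

/-- Few members of a scale meet a given small set of values unboundedly often. -/
theorem IsScale.mk_meeting_le {K W₁ V₂ W L : Type} {V : K → Type} [LinearOrder K] [LinearOrder W₁]
    [LinearOrder V₂] [LinearOrder W] [LinearOrder L] [∀ i, LinearOrder (V i)] [RegularOrder K]
    [RegularOrder W₁] [RegularOrder V₂] [RegularOrder W] [RegularOrder L]
    (h₁ : #K < #W₁) (h₂ : #W₁ < #V₂) (h₃ : #V₂ < #W) (h₄ : #W < #L)
    {f : L → ∀ i, V i} (hf : IsScale (W := W) f) (Y : Set (Σ i, V i)) (hY : #Y ≤ #K) :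
    #{δ | ∀ i₀, ∃ i, i₀ ≤ i ∧ (⟨i, f δ i⟩ : Σ i, V i) ∈ Y} ≤ #W := by
  classical
  obtain ⟨c, hc⟩ := exists_club_guessing h₂ h₃
  set A := {δ | ∀ i₀, ∃ i, i₀ ≤ i ∧ (⟨i, f δ i⟩ : Σ i, V i) ∈ Y} with hA
  by_contra! hcon
  let T := (Order.succ #W).ord.ToType
  have hTreg : RegularOrder T := regularOrder_toType (Cardinal.isRegular_succ RegularOrder.aleph0_le)
  have hT : #T = Order.succ #W := by simp [T]
  have hWT : #W < #T := hT ▸ Order.lt_succ _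
  have hdex : ∃ d : T → L, StrictMono d ∧ ∀ t, d t ∈ A := by
    have h5 : (Order.succ #W).ord ≤ Ordinal.type (α := A) (· < ·) :=
      Cardinal.ord_le_type _ |>.trans' (Cardinal.ord_le_ord.2 (Order.succ_le_of_lt hcon))
    rw [← Ordinal.type_toType (Order.succ #W).ord, Ordinal.type_le_iff'] at h5
    obtain ⟨e⟩ := h5
    exact ⟨fun t => e t, fun s t h => e.map_rel_iff.2 h, fun t => (e t).2⟩
  obtain ⟨d, hd, hdA⟩ := hdex
  let Le : ∀ i : K, L → L → Prop := fun i x y =>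
    ∀ u : V i, (⟨i, u⟩ : Σ i, V i) ∈ Y → f y i ≤ u → f x i ≤ u
  let Wit : ∀ (γ ζ : W), (Set.Iio ζ → L) → L → Prop := fun γ ζ x α =>
    ∃ i₀, ∀ i, i₀ ≤ i → ∀ ζ' : Set.Iio ζ, (ζ' : W) ∈ c γ → Le i (x ζ') α
  obtain ⟨G, hG⟩ := exists_wf_rec (W := W) (X := L × T)
    (fun ζ F p => IsLeast {x | ∀ ζ', d (F ζ').2 < x} p.1 ∧ (∀ ζ', (F ζ').2 < p.2) ∧
      ∀ γ, (∃ q, ∃ α ≤ d q, Wit γ ζ (fun ζ' => (F ζ').1) α) →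
        ∃ α ≤ d p.2, Wit γ ζ (fun ζ' => (F ζ').1) α) fun ζ F => by
    obtain ⟨y, hy⟩ := RegularOrder.exists_bound_range (fun ζ' => d (F ζ').2)
      ((RegularOrder.mk_Iio_lt ζ).trans h₄)
    obtain ⟨x, hx1, hx2⟩ := (wellFounded_lt (α := L)).has_min {x | ∀ ζ', d (F ζ').2 < x} ⟨y, hy⟩
    obtain ⟨p₁, hp₁⟩ := RegularOrder.exists_bound_range (fun ζ' => (F ζ').2)
      ((RegularOrder.mk_Iio_lt ζ).trans hWT)
    have hq : ∀ γ, ∃ q, (∃ q, ∃ α ≤ d q, Wit γ ζ (fun ζ' => (F ζ').1) α) →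
        ∃ α ≤ d q, Wit γ ζ (fun ζ' => (F ζ').1) α := by
      intro γ
      by_cases h : ∃ q, ∃ α ≤ d q, Wit γ ζ (fun ζ' => (F ζ').1) α
      · obtain ⟨q, hq⟩ := h
        exact ⟨q, fun _ => hq⟩
      · exact ⟨p₁, fun h' => absurd h' h⟩
    choose q hq using hq
    obtain ⟨p₂, hp₂⟩ := RegularOrder.exists_bound_range q hWT
    refine ⟨(x, max p₁ p₂), ⟨hx1, fun z hz => not_lt.1 (hx2 z hz)⟩,
      fun ζ' => lt_max_of_lt_left (hp₁ ζ'), fun γ h => ?_⟩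
    obtain ⟨α, hα, hw⟩ := hq γ h
    exact ⟨α, hα.trans (hd.monotone ((hp₂ γ).le.trans (le_max_right _ _))), hw⟩
  let ξ : W → L := fun ζ => (G ζ).1
  let g : W → T := fun ζ => (G ζ).2
  have hξlt : ∀ ζ' ζ, ζ' < ζ → d (g ζ') < ξ ζ := fun ζ' ζ h => (hG ζ).1.1 ⟨ζ', h⟩
  have hξleast : ∀ ζ x, (∀ ζ' < ζ, d (g ζ') < x) → ξ ζ ≤ x := fun ζ x h =>
    (hG ζ).1.2 fun ζ' => h ζ' ζ'.2
  have hgmono : StrictMono g := fun ζ' ζ h => (hG ζ).2.1 ⟨ζ', h⟩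
  have hξd : ∀ ζ, ξ ζ ≤ d (g ζ) := fun ζ => hξleast ζ _ fun ζ' h => hd (hgmono h)
  have hξmono : StrictMono ξ := fun ζ' ζ h => (hξd ζ').trans_lt (hξlt ζ' ζ h)
  have hξcont : IsContLadder ξ := by
    refine ⟨hξmono, fun s ζ _ hζ => ⟨?_, fun u hu => ?_⟩⟩
    · rintro _ ⟨z, hz, rfl⟩
      exact hξmono.monotone (hζ.1 hz)
    · by_cases hmem : ζ ∈ s
      · exact hu ⟨ζ, hmem, rfl⟩
      · refine hξleast ζ u fun ζ' hζ' => ?_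
        obtain ⟨z, hz, hlt⟩ := (lt_isLUB_iff hζ).1 hζ'
        exact (hξlt ζ' z hlt).trans_le (hu ⟨z, hz, rfl⟩)
  obtain ⟨δ, hδ⟩ := RegularOrder.exists_isLUB_range ξ h₄
  obtain ⟨C, hC, hCf⟩ := hf.exists_club ξ hξcont δ hδ
  obtain ⟨γ, hγC, ⟨z₀, hz₀⟩, hγdir⟩ := hc C hC
  obtain ⟨q, hq⟩ := RegularOrder.exists_bound_range g hWT
  have hδq : δ ≤ d q := hδ.2 (by
    rintro _ ⟨ζ, rfl⟩
    exact (hξd ζ).trans (hd (hq ζ)).le)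
  obtain ⟨i₁⟩ := RegularOrder.nonempty' K
  have hwit : ∀ ζ, ∃ α ≤ d (g ζ), Wit γ ζ (fun ζ' => ξ ζ') α := fun ζ =>
    (hG ζ).2.2 γ ⟨q, δ, hδq, i₁, fun i _ ζ' hζ' u _ hle => (hCf _ (hγC hζ') i).le.trans hle⟩
  have hpick : ∀ p : Y, ∃ ζ ∈ c γ, (∃ ζ' ∈ c γ, p.1.2 < f (ξ ζ') p.1.1) →
      p.1.2 < f (ξ ζ) p.1.1 := by
    intro p
    by_cases h : ∃ ζ' ∈ c γ, p.1.2 < f (ξ ζ') p.1.1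
    · obtain ⟨ζ', h1, h2⟩ := h
      exact ⟨ζ', h1, fun _ => h2⟩
    · exact ⟨z₀, hz₀, fun h' => absurd h' h⟩
  choose z hzc hz using hpick
  obtain ⟨ζ₀, hζ₀c, hζ₀⟩ := hγdir (Set.range z) (by rintro _ ⟨p, rfl⟩; exact hzc p)
    (Cardinal.mk_range_le.trans_lt (hY.trans_lt h₁))
  have hnext : ∀ ζ ∈ c γ, ∃ ζ' ∈ c γ, ζ < ζ' := by
    intro ζ hζ
    obtain ⟨y, hy, h⟩ := hγdir {ζ} (by simpa using hζ)
      (by simpa using Cardinal.one_lt_aleph0.trans_le (RegularOrder.aleph0_le (X := W₁)))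
    exact ⟨y, hy, h ζ rfl⟩
  obtain ⟨ζ₁, hζ₁c, h01⟩ := hnext ζ₀ hζ₀c
  obtain ⟨ζ₂, hζ₂c, h12⟩ := hnext ζ₁ hζ₁c
  obtain ⟨α, hα, i₂, hi₂⟩ := hwit ζ₀
  obtain ⟨i₃, hi₃⟩ := hf.eventually_lt α (ξ ζ₁) (hα.trans_lt (hξlt _ _ h01))
  have hle1 : ∃ i₄, ∀ i, i₄ ≤ i → f (ξ ζ₁) i ≤ f (d (g ζ₁)) i := by
    rcases (hξd ζ₁).eq_or_lt with h | h
    · exact ⟨i₁, fun i _ => by rw [← h]⟩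
    · obtain ⟨i₄, h4⟩ := hf.eventually_lt _ _ h
      exact ⟨i₄, fun i hi => (h4 i hi).le⟩
  obtain ⟨i₄, hi₄⟩ := hle1
  obtain ⟨i₅, hi₅⟩ := hf.eventually_lt _ _ (hξlt _ _ h12)
  obtain ⟨i, hi, hiY⟩ := hdA (g ζ₁) (max (max i₂ i₃) (max i₄ i₅))
  simp only [max_le_iff] at hi
  have hlt := hi₅ i hi.2.2
  have h6 := hz ⟨_, hiY⟩ ⟨ζ₂, hζ₂c, hlt⟩
  have h7 : z ⟨_, hiY⟩ < ζ₀ := hζ₀ _ ⟨_, rfl⟩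
  have h8 := hi₂ i hi.1.1 ⟨_, h7⟩ (hzc _) (f (d (g ζ₁)) i) hiY
    ((hi₃ i hi.1.2).le.trans (hi₄ i hi.2.1))
  exact absurd h6 (not_lt.2 h8)

theorem RegularOrder.exists_frequently_of_cof_ne {X J : Type} [LinearOrder X] [RegularOrder X]
    [LinearOrder J] (hJ : Order.cof J ≠ #X) (I : X → J → Prop)
    (hI : ∀ x j j', j ≤ j' → I x j → I x j') (H : ∀ x₀, ∃ x, x₀ ≤ x ∧ ∃ j, I x j) :
    ∃ j, ∀ x₀, ∃ x, x₀ ≤ x ∧ I x j := by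
  rcases lt_or_gt_of_ne hJ with h | h
  · by_contra! hcon
    choose b hb using hcon
    obtain ⟨s, hs, hsc⟩ := Order.exists_cof_eq J
    obtain ⟨y, hy⟩ := exists_bound_range (fun j : s => b j) (hsc.trans_lt h)
    obtain ⟨x, hx, j, hj⟩ := H y
    obtain ⟨j', hj', hle⟩ := hs j
    exact hb j' x ((hy ⟨j', hj'⟩).le.trans hx) (hI x j j' hle hj)
  · choose x hx j hj using H
    have h1 : ¬ IsCofinal (Set.range j) := fun hc =>
      absurd ((Order.cof_le hc).trans Cardinal.mk_range_le) (not_le.2 h)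
    simp only [IsCofinal, Set.mem_range, exists_exists_eq_and, not_forall, not_exists, not_le] at h1
    obtain ⟨j', hj'⟩ := h1
    exact ⟨j', fun x₀ => ⟨x x₀, hx x₀, hI _ _ _ (hj' x₀).le (hj x₀)⟩⟩

/-- `ψ δ` agrees at unboundedly many places with members of `ψ '' D`. -/
def FreqMeets {L X V : Type} [LE X] (ψ : L → X → V) (D : Set L) (δ : L) : Prop :=
  ∀ x₀, ∃ x, x₀ ≤ x ∧ ∃ δ' ∈ D, ψ δ' x = ψ δ x

theorem FreqMeets.mono {L X V : Type} [LE X] {ψ : L → X → V} {D D' : Set L} {δ : L}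
    (h : FreqMeets ψ D δ) (hD : D ⊆ D') : FreqMeets ψ D' δ := fun x₀ => by
  obtain ⟨x, hx, δ', hδ', h'⟩ := h x₀
  exact ⟨x, hx, δ', hD hδ', h'⟩

theorem FreqMeets.exists_of_iUnion {L X V J : Type} [LinearOrder X] [RegularOrder X] [LinearOrder J]
    (hJ : Order.cof J ≠ #X) {ψ : L → X → V} {C : J → Set L} (hC : Monotone C) {δ : L}
    (h : FreqMeets ψ (⋃ j, C j) δ) : ∃ j, FreqMeets ψ (C j) δ := by
  refine RegularOrder.exists_frequently_of_cof_ne hJ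
    (fun x j => ∃ δ' ∈ C j, ψ δ' x = ψ δ x) ?_ fun x₀ => ?_
  · rintro x j j' hj ⟨δ', h1, h2⟩
    exact ⟨δ', hC hj h1, h2⟩
  · obtain ⟨x, hx, δ', hδ', h'⟩ := h x₀
    obtain ⟨j, hj⟩ := Set.mem_iUnion.1 hδ'
    exact ⟨x, hx, j, δ', hj, h'⟩

theorem mk_iUnion_le_max {ι α : Type} (f : ι → Set α) {c : Cardinal.{0}} (hc : ℵ₀ ≤ c)
    (hι : #ι ≤ c) (hf : ∀ i, #(f i) ≤ c) : #(⋃ i, f i) ≤ c := by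
  refine Cardinal.mk_iUnion_le_sum_mk.trans ((Cardinal.sum_le_sum _ _ hf).trans ?_)
  rw [Cardinal.sum_const']
  exact Cardinal.mul_le_of_le hc hι le_rfl

theorem mk_frequently_le {K L U : Type} [LinearOrder K] [RegularOrder K] (φ : L → K → U)
    {θ μ : Cardinal.{0}}
    (h₀ : ∀ Y : Set U, #Y ≤ #K → #{δ | ∀ i₀, ∃ i, i₀ ≤ i ∧ φ δ i ∈ Y} ≤ θ)
    (hcof : ∀ τ, #K < τ → τ < μ → τ.ord.cof ≠ #K) (Y : Set U) (hY : #Y < μ) :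
    #{δ | ∀ i₀, ∃ i, i₀ ≤ i ∧ φ δ i ∈ Y} ≤ max #Y θ := by
  induction hτ : #Y using WellFoundedLT.induction generalizing Y with
  | ind τ ih =>
  rcases le_or_gt #Y #K with hle | hlt
  · exact (h₀ Y hle).trans (le_max_right _ _)
  obtain ⟨e⟩ : Nonempty (Y ≃ τ.ord.ToType) := Cardinal.eq.1 (by simp [hτ])
  let Z : τ.ord.ToType → Set U := fun j => Subtype.val '' {y | e y < j}
  have hZ : ∀ j, #(Z j) < τ := fun j => by
    have h : #(Set.Iio j) < τ := by simpa using Cardinal.mk_Iio_lt j (by simp)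
    refine Cardinal.mk_image_le.trans_lt (lt_of_le_of_lt ?_ h)
    exact Cardinal.mk_le_of_injective (f := fun y : {y | e y < j} => (⟨e y, y.2⟩ : Set.Iio j))
      fun y y' h => Subtype.ext (e.injective (congrArg Subtype.val h))
  have hτ₀ : ℵ₀ ≤ τ := RegularOrder.aleph0_le.trans (hτ ▸ hlt.le)
  have : NoMaxOrder τ.ord.ToType := Cardinal.noMaxOrder hτ₀
  have hsub : {δ | ∀ i₀, ∃ i, i₀ ≤ i ∧ φ δ i ∈ Y} ⊆
      ⋃ j, {δ | ∀ i₀, ∃ i, i₀ ≤ i ∧ φ δ i ∈ Z j} := by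
    intro δ hδ
    refine Set.mem_iUnion.2 (RegularOrder.exists_frequently_of_cof_ne ?_
      (fun i j => φ δ i ∈ Z j) ?_ fun i₀ => ?_)
    · rw [Ordinal.cof_toType]
      exact hcof τ (hτ ▸ hlt) (hτ ▸ hY)
    · rintro x j j' hj ⟨y, hy, hy'⟩
      exact ⟨y, lt_of_lt_of_le hy hj, hy'⟩
    · obtain ⟨i, hi, hiY⟩ := hδ i₀
      obtain ⟨j, hj⟩ := exists_gt (e ⟨_, hiY⟩)
      exact ⟨i, hi, j, ⟨_, hiY⟩, hj, rfl⟩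
  refine (Cardinal.mk_le_mk_of_subset hsub).trans (mk_iUnion_le_max _ ?_ ?_ fun j => ?_)
  · exact hτ₀.trans (le_max_left _ _)
  · simp
  · refine (ih _ (hZ j) (Z j) ((hZ j).trans (hτ ▸ hY)) rfl).trans ?_
    exact max_le_max (hZ j).le le_rfl

theorem mk_freqMeets_le {K L U : Type} [LinearOrder K] [RegularOrder K] (φ : L → K → U)
    {θ μ : Cardinal.{0}} (hKθ : #K ≤ θ) (hKμ : #K < μ)
    (h₀ : ∀ Y : Set U, #Y ≤ #K → #{δ | ∀ i₀, ∃ i, i₀ ≤ i ∧ φ δ i ∈ Y} ≤ θ)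
    (hcof : ∀ τ, #K < τ → τ < μ → τ.ord.cof ≠ #K) (D : Set L) (hD : #D < μ) :
    #{δ | FreqMeets φ D δ} ≤ max #D θ := by
  let Y : Set U := Set.range fun p : D × K => φ p.1 p.2
  have hY : #Y ≤ #D * #K := by
    rw [Cardinal.mul_def]
    exact Cardinal.mk_range_le
  have hK := RegularOrder.aleph0_le (X := K)
  have hsub : {δ | FreqMeets φ D δ} ⊆ {δ | ∀ i₀, ∃ i, i₀ ≤ i ∧ φ δ i ∈ Y} := by
    intro δ hδ i₀
    obtain ⟨i, hi, δ', hδ', h⟩ := hδ i₀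
    exact ⟨i, hi, (⟨δ', hδ'⟩, i), h⟩
  refine (Cardinal.mk_le_mk_of_subset hsub).trans ((mk_frequently_le φ h₀ hcof Y
    (hY.trans_lt (Cardinal.mul_lt_of_lt (hK.trans hKμ.le) hD hKμ))).trans ?_)
  refine max_le (hY.trans ?_) (le_max_right _ _)
  exact Cardinal.mul_le_of_le (hK.trans (hKθ.trans (le_max_right _ _))) (le_max_left _ _)
    (hKθ.trans (le_max_right _ _))

theorem IsLadderSystem.mk_freqMeets_le {Th L : Type} [LinearOrder Th] [LinearOrder L]
    [RegularOrder Th] [WellFoundedLT L] {S : Set L} {a : L → Th → L} (ha : IsLadderSystem S a)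
    (D : Set L) : #{δ | δ ∈ S ∧ FreqMeets a D δ} ≤ max #D #Th := by
  classical
  let A : Set L := Set.range fun p : D × Th => a p.1 p.2
  have hTh := RegularOrder.aleph0_le (X := Th)
  have hA : #A ≤ max #D #Th := by
    refine (Cardinal.mk_range_le.trans_eq (Cardinal.mul_def _ _).symm).trans ?_
    exact Cardinal.mul_le_of_le (hTh.trans (le_max_right _ _)) (le_max_left _ _) (le_max_right _ _)
  have hmin : ∀ δ : L, ∃ q : Option A, (∀ x : A, δ ≤ x → ∃ y ∈ q, (y : L) ≤ x) ∧
      ∀ y ∈ q, δ ≤ (y : L) := by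
    intro δ
    by_cases h : ∃ x : A, δ ≤ x
    · obtain ⟨y, h1, h2⟩ := (wellFounded_lt (α := A)).has_min {x : A | δ ≤ x} h
      exact ⟨some y, fun x hx => ⟨y, rfl, not_lt.1 (h2 x hx)⟩, by rintro _ ⟨⟩; exact h1⟩
    · exact ⟨none, fun x hx => absurd ⟨x, hx⟩ h, by simp⟩
  choose q hq hq' using hmin
  have hlt : ∀ δ δ', δ' ∈ S → FreqMeets a D δ' → δ < δ' → q δ ≠ q δ' := by
    intro δ δ' hS hm h heq
    obtain ⟨ξ₀, hξ₀⟩ := ha.exists_le hS h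
    obtain ⟨ξ, hξ, δ'', hδ'', hx⟩ := hm ξ₀
    obtain ⟨y, hy, hy'⟩ := hq δ ⟨a δ' ξ, (⟨δ'', hδ''⟩, ξ), hx⟩
      (hξ₀.trans ((ha.strictMono δ' hS).monotone hξ))
    exact absurd ((hq' δ' y (heq ▸ hy)).trans hy') (not_le.2 (ha.lt hS ξ))
  have hinj : Function.Injective fun δ : {δ | δ ∈ S ∧ FreqMeets a D δ} => q δ := by
    intro δ δ' h
    by_contra hne
    rcases lt_or_gt_of_ne hne with h' | h'
    · exact hlt _ _ δ'.2.1 δ'.2.2 h' h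
    · exact hlt _ _ δ.2.1 δ.2.2 h' h.symm
  refine (Cardinal.mk_le_of_injective hinj).trans ?_
  rw [Cardinal.mk_option]
  exact Cardinal.add_le_of_le (hTh.trans (le_max_right _ _)) hA
    (Cardinal.one_le_aleph0.trans (hTh.trans (le_max_right _ _)))

section Closure

variable {K Th L U : Type} [LinearOrder K] [LinearOrder Th]

/-- `C` contains every `δ ∈ S` for which `φ δ` or `a δ` meets `C` unboundedly often. -/
def MeetClosed (S : Set L) (φ : L → K → U) (a : L → Th → L) (C : Set L) : Prop :=
  ∀ δ ∈ S, FreqMeets φ C δ ∨ FreqMeets a C δ → δ ∈ C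

/-- The least `MeetClosed` set containing `D`. -/
def meetClosure (S : Set L) (φ : L → K → U) (a : L → Th → L) (D : Set L) : Set L :=
  ⋂₀ {C | D ⊆ C ∧ MeetClosed S φ a C}

variable {S : Set L} {φ : L → K → U} {a : L → Th → L} {D D' C : Set L}

theorem subset_meetClosure : D ⊆ meetClosure S φ a D := Set.subset_sInter fun _ h => h.1

theorem meetClosure_subset (h : D ⊆ C) (hC : MeetClosed S φ a C) : meetClosure S φ a D ⊆ C :=
  Set.sInter_subset_of_mem ⟨h, hC⟩

theorem meetClosed_meetClosure : MeetClosed S φ a (meetClosure S φ a D) := by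
  intro δ hδ h C hC
  have hsub := meetClosure_subset hC.1 hC.2
  exact hC.2 δ hδ (h.imp (·.mono hsub) (·.mono hsub))

theorem meetClosure_mono (h : D ⊆ D') : meetClosure S φ a D ⊆ meetClosure S φ a D' :=
  meetClosure_subset (h.trans subset_meetClosure) meetClosed_meetClosure

theorem mk_meetClosure_le [RegularOrder K] [RegularOrder Th] {W₁ : Type} [LinearOrder W₁]
    [RegularOrder W₁] (h₁ : #K < #W₁) (h₂ : #W₁ < #Th) {μ : Cardinal.{0}} (hμ : #Th < μ)
    (hφ : ∀ D : Set L, #D < μ → #{δ | FreqMeets φ D δ} ≤ max #D #Th)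
    (ha : ∀ D : Set L, #{δ | δ ∈ S ∧ FreqMeets a D δ} ≤ max #D #Th) (hD : #D < μ) :
    #(meetClosure S φ a D) ≤ max #D #Th := by
  let bad : Set L → Set L := fun C => {δ | FreqMeets φ C δ} ∪ {δ | δ ∈ S ∧ FreqMeets a C δ}
  obtain ⟨C, hC⟩ := exists_wf_rec (W := W₁) (X := Set L)
    (fun ζ f E => E = D ∪ bad (⋃ ζ', f ζ')) fun ζ f => ⟨_, rfl⟩
  have hcof : Order.cof W₁ = #W₁ :=
    le_antisymm (Order.cof_le_cardinalMk W₁) (RegularOrder.mk_le_cof W₁)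
  have hbad : ∀ E E', E ⊆ E' → bad E ⊆ bad E' := fun E E' h =>
    Set.union_subset_union (fun δ hδ => FreqMeets.mono hδ h) fun δ hδ => ⟨hδ.1, hδ.2.mono h⟩
  have hmono : Monotone C := fun ζ ζ' h => by
    rw [hC ζ, hC ζ']
    refine Set.union_subset_union_right _ (hbad _ _ ?_)
    exact Set.iUnion_subset fun z => Set.subset_iUnion_of_subset ⟨z.1, lt_of_lt_of_le z.2 h⟩ le_rfl
  have hTh : ℵ₀ ≤ max #D #Th := RegularOrder.aleph0_le.trans (le_max_right _ _)
  have hcard : ∀ ζ, #(C ζ) ≤ max #D #Th := by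
    intro ζ
    induction ζ using WellFoundedLT.induction with
    | ind ζ ih =>
    have hU : #(⋃ ζ' : Set.Iio ζ, C ζ') ≤ max #D #Th :=
      mk_iUnion_le_max _ hTh (((RegularOrder.mk_Iio_lt ζ).trans h₂).le.trans (le_max_right _ _))
        fun ζ' => ih ζ' ζ'.2
    have hU' : max #(⋃ ζ' : Set.Iio ζ, C ζ') #Th ≤ max #D #Th := max_le hU (le_max_right _ _)
    rw [hC ζ]
    refine (Cardinal.mk_union_le _ _).trans (Cardinal.add_le_of_le hTh (le_max_left _ _) ?_)
    refine (Cardinal.mk_union_le _ _).trans (Cardinal.add_le_of_le hTh ?_ ((ha _).trans hU'))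
    exact (hφ _ (hU.trans_lt (max_lt hD hμ))).trans hU'
  have hclosed : MeetClosed S φ a (⋃ ζ, C ζ) := by
    intro δ hδ h
    have h3 : ∃ ζ, FreqMeets φ (C ζ) δ ∨ FreqMeets a (C ζ) δ := by
      rcases h with h | h
      · obtain ⟨ζ, hζ⟩ := h.exists_of_iUnion (by rw [hcof]; exact h₁.ne') hmono
        exact ⟨ζ, Or.inl hζ⟩
      · obtain ⟨ζ, hζ⟩ := h.exists_of_iUnion (by rw [hcof]; exact h₂.ne) hmono
        exact ⟨ζ, Or.inr hζ⟩
    obtain ⟨ζ, hζ⟩ := h3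
    obtain ⟨ζ', hζ'⟩ := exists_gt ζ
    refine Set.mem_iUnion.2 ⟨ζ', ?_⟩
    rw [hC ζ']
    have hsub : C ζ ⊆ ⋃ z : Set.Iio ζ', C z := Set.subset_iUnion_of_subset ⟨ζ, hζ'⟩ le_rfl
    exact Or.inr (hbad _ _ hsub (hζ.imp id fun h => ⟨hδ, h⟩))
  obtain ⟨ζ₀⟩ := RegularOrder.nonempty' W₁
  have hDC : D ⊆ ⋃ ζ, C ζ := by
    refine Set.subset_iUnion_of_subset ζ₀ ?_
    rw [hC ζ₀]
    exact Set.subset_union_left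
  refine (Cardinal.mk_le_mk_of_subset (meetClosure_subset hDC hclosed)).trans ?_
  exact mk_iUnion_le_max _ hTh (h₂.le.trans (le_max_right _ _)) hcard

theorem GoodOrder.of_injOn {A : Type*} [LinearOrder A] [WellFoundedLT A] (g : L → A)
    (hg : Set.InjOn g D) (h : ∀ δ ∈ D, ∃ i₀ ξ₀, ∀ δ' ∈ D, g δ' < g δ →
      ∀ i ξ, φ δ' i = φ δ i → a δ' ξ = a δ ξ → i < i₀ ∨ ξ < ξ₀) : GoodOrder φ a D := by
  classical
  let _ : LinearOrder D := LinearOrder.lift' (fun δ : D => g δ) fun δ δ' h =>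
    Subtype.ext (hg δ.2 δ'.2 h)
  have hlt : ∀ δ δ' : D, δ < δ' ↔ g δ < g δ' := fun _ _ => Iff.rfl
  have : WellFoundedLT D := ⟨(InvImage.wf (fun δ : D => g δ) (wellFounded_lt (α := A)))⟩
  let G : L → Ordinal.{0} := fun δ =>
    if h : δ ∈ D then Ordinal.typein (α := D) (· < ·) ⟨δ, h⟩ else 0
  have hG : ∀ δ (h : δ ∈ D), G δ = Ordinal.typein (α := D) (· < ·) ⟨δ, h⟩ := fun δ h => dif_pos h
  refine ⟨G, fun δ hδ δ' hδ' h => ?_, fun δ hδ => ?_⟩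
  · rw [hG δ hδ, hG δ' hδ'] at h
    exact congrArg Subtype.val (Ordinal.typein_injective _ h)
  · obtain ⟨i₀, ξ₀, h'⟩ := h δ hδ
    refine ⟨i₀, ξ₀, fun δ' hδ' hlt' => h' δ' hδ' ?_⟩
    rwa [hG δ' hδ', hG δ hδ, Ordinal.typein_lt_typein, hlt] at hlt'

variable [RegularOrder K] [RegularOrder Th]

theorem MeetClosed.exists_bound_of_iUnion {J : Type} [LinearOrder J] (hne : #K ≠ #Th)
    {C : J → Set L} (hC : Monotone C) (hcl : ∀ j, MeetClosed S φ a (C j)) {δ : L} (hδ : δ ∈ S)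
    (hn : ∀ j, δ ∉ C j) : ∃ i₀ ξ₀, ∀ j, ∀ δ' ∈ C j, ∀ i ξ, φ δ' i = φ δ i → a δ' ξ = a δ ξ →
      i < i₀ ∨ ξ < ξ₀ := by
  obtain ⟨i₁⟩ := RegularOrder.nonempty' K
  obtain ⟨ξ₁⟩ := RegularOrder.nonempty' Th
  by_contra! hcon
  have h1 : FreqMeets φ (⋃ j, C j) δ := fun i₀ => by
    obtain ⟨j, δ', hδ', i, ξ, h1, _, h3, _⟩ := hcon i₀ ξ₁
    exact ⟨i, h3, δ', Set.mem_iUnion.2 ⟨j, hδ'⟩, h1⟩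
  have h2 : FreqMeets a (⋃ j, C j) δ := fun ξ₀ => by
    obtain ⟨j, δ', hδ', i, ξ, _, h2, _, h4⟩ := hcon i₁ ξ₀
    exact ⟨ξ, h4, δ', Set.mem_iUnion.2 ⟨j, hδ'⟩, h2⟩
  by_cases hJ : Order.cof J = #K
  · obtain ⟨j, hj⟩ := h2.exists_of_iUnion (hJ ▸ hne) hC
    exact hn j (hcl j δ hδ (Or.inr hj))
  · obtain ⟨j, hj⟩ := h1.exists_of_iUnion hJ hC
    exact hn j (hcl j δ hδ (Or.inl hj))

theorem IsLadderSystem.goodOrder [LinearOrder L] {W₁ : Type} [LinearOrder W₁]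
    [RegularOrder W₁] (h₁ : #K < #W₁) (h₂ : #W₁ < #Th) {μ : Cardinal.{0}} (hμ : #Th < μ)
    (ha : IsLadderSystem S a)
    (hφ : ∀ D : Set L, #D < μ → #{δ | FreqMeets φ D δ} ≤ max #D #Th)
    (ha' : ∀ D : Set L, #{δ | δ ∈ S ∧ FreqMeets a D δ} ≤ max #D #Th)
    (D : Set L) (hDS : D ⊆ S) (hD : #D ≤ μ) : GoodOrder φ a D := by
  induction hσ : #D using WellFoundedLT.induction generalizing D with
  | ind σ ih =>
  have := RegularOrder.nonempty' K
  rcases le_or_gt #D #Th with hle | hlt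
  · exact ha.goodOrder_of_mk_le φ hDS hle
  obtain ⟨e⟩ : Nonempty (D ≃ σ.ord.ToType) := Cardinal.eq.1 (by simp [hσ])
  have hσ₀ : ℵ₀ ≤ σ := RegularOrder.aleph0_le.trans (hσ ▸ hlt.le)
  have : NoMaxOrder σ.ord.ToType := Cardinal.noMaxOrder hσ₀
  let E : σ.ord.ToType → Set L := fun j => Subtype.val '' {y | e y < j}
  have hE : ∀ j, #(E j) < σ := fun j => by
    have h : #(Set.Iio j) < σ := by simpa using Cardinal.mk_Iio_lt j (by simp)
    refine Cardinal.mk_image_le.trans_lt (lt_of_le_of_lt ?_ h)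
    exact Cardinal.mk_le_of_injective (f := fun y : {y | e y < j} => (⟨e y, y.2⟩ : Set.Iio j))
      fun y y' h => Subtype.ext (e.injective (congrArg Subtype.val h))
  let C : σ.ord.ToType → Set L := fun j => meetClosure S φ a (E j)
  have hCmono : Monotone C := fun j j' h =>
    meetClosure_mono (Set.image_mono fun y hy => lt_of_lt_of_le hy h)
  have hCcl : ∀ j, MeetClosed S φ a (C j) := fun j => meetClosed_meetClosure
  have hCS : ∀ j, C j ⊆ S := fun j =>
    meetClosure_subset (by rintro _ ⟨y, _, rfl⟩; exact hDS y.2) fun δ hδ _ => hδ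
  have hCcard : ∀ j, #(C j) < σ := fun j =>
    (mk_meetClosure_le h₁ h₂ hμ hφ ha' ((hE j).trans_le (hσ ▸ hD))).trans_lt
      (max_lt (hE j) (hσ ▸ hlt))
  have hCgood := fun j => ih _ (hCcard j) (C j) (hCS j) ((hCcard j).le.trans (hσ ▸ hD)) rfl
  choose g hginj hg using hCgood
  have hcov : ∀ δ ∈ D, ∃ j, δ ∈ C j ∧ ∀ j', j' < j → δ ∉ C j' := by
    intro δ hδ
    obtain ⟨j, hj⟩ := exists_gt (e ⟨δ, hδ⟩)
    obtain ⟨j₀, h1, h2⟩ := (wellFounded_lt (α := σ.ord.ToType)).has_min {j | δ ∈ C j}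
      ⟨j, subset_meetClosure ⟨⟨δ, hδ⟩, hj, rfl⟩⟩
    exact ⟨j₀, h1, fun j' h h' => h2 j' h' h⟩
  have : Nonempty σ.ord.ToType :=
    Cardinal.mk_ne_zero_iff.1 (by simpa using (Cardinal.aleph0_pos.trans_le hσ₀).ne')
  choose! ρ hρ hρ' using hcov
  refine GoodOrder.of_injOn (fun δ => toLex (ρ δ, g (ρ δ) δ)) ?_ ?_
  · intro δ hδ δ' hδ' h
    obtain ⟨h1, h2⟩ := Prod.ext_iff.1 (toLex.injective h)
    simp only at h1 h2
    rw [← h1] at h2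
    exact hginj (ρ δ) (hρ δ hδ) (h1 ▸ hρ δ' hδ') h2
  · intro δ hδ
    obtain ⟨i₀, ξ₀, h1⟩ := hg (ρ δ) δ (hρ δ hδ)
    obtain ⟨i₁, ξ₁, h2⟩ := MeetClosed.exists_bound_of_iUnion (h₁.trans h₂).ne
      (C := fun j : Set.Iio (ρ δ) => C j) (fun j j' h => hCmono h) (fun j => hCcl j) (hDS hδ)
      fun j => hρ' δ hδ j j.2
    refine ⟨max i₀ i₁, max ξ₀ ξ₁, fun δ' hδ' hlt' i ξ hi hξ => ?_⟩
    simp only [lt_max_iff]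
    rcases Prod.Lex.toLex_lt_toLex.1 hlt' with h | ⟨h, h'⟩
    · have h3 := h2 ⟨ρ δ', h⟩ δ' (hρ δ' hδ') i ξ hi hξ
      tauto
    · simp only at h h'
      rw [h] at h'
      have h3 := h1 δ' (h ▸ hρ δ' hδ') h' i ξ hi hξ
      tauto

end Closure

theorem exists_aleph_of_lt {κ τ : Cardinal.{0}} (hκ : ℵ₀ ≤ κ) (hτ : τ < ℵ_ κ.ord) :
    ∃ α < κ.ord, τ ≤ ℵ_ α ∧ (ℵ₀ ≤ τ → τ = ℵ_ α) := by
  by_cases h : ℵ₀ ≤ τ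
  · obtain ⟨α, rfl⟩ := Cardinal.mem_range_aleph_iff.2 h
    exact ⟨α, Cardinal.aleph_lt_aleph.1 hτ, le_rfl, fun _ => rfl⟩
  · exact ⟨0, (Cardinal.isSuccLimit_ord hκ).bot_lt, by simpa using (not_le.1 h).le,
      fun h' => absurd h' h⟩

theorem succ_lt_aleph_ord {κ τ : Cardinal.{0}} (hκ : ℵ₀ ≤ κ) (hτ : τ < ℵ_ κ.ord) :
    Order.succ τ < ℵ_ κ.ord := by
  obtain ⟨α, hα, h, -⟩ := exists_aleph_of_lt hκ hτ
  refine (Order.succ_le_succ h).trans_lt ?_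
  rw [Cardinal.succ_aleph, Cardinal.aleph_lt_aleph]
  exact (Cardinal.isSuccLimit_ord hκ).add_one_lt hα

theorem cof_ord_ne_of_lt_aleph_ord {κ τ : Cardinal.{0}} (hκ : ℵ₀ ≤ κ) (h₁ : κ < τ)
    (h₂ : τ < ℵ_ κ.ord) : τ.ord.cof ≠ κ := by
  obtain ⟨α, hα, -, h⟩ := exists_aleph_of_lt hκ h₂
  obtain rfl := h (hκ.trans h₁.le)
  by_cases hr : (ℵ_ α).IsRegular
  · rw [hr.cof_ord]
    exact h₁.ne'
  · have hlim : Order.IsSuccLimit α := by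
      rcases Ordinal.zero_or_succ_or_isSuccLimit α with rfl | ⟨β, rfl⟩ | h
      · exact absurd (by simpa using Cardinal.isRegular_aleph0) hr
      · exact absurd (Cardinal.isRegular_aleph_add_one β) hr
      · exact h
    rw [Cardinal.ord_aleph, Ordinal.cof_omega hlim]
    exact ((Ordinal.cof_le_card α).trans_lt (Cardinal.lt_ord.1 hα)).ne

theorem HasSys.succ_aleph_ord {K Th L : Type} [LinearOrder K] [LinearOrder Th] [LinearOrder L]
    [RegularOrder K] [RegularOrder Th] [RegularOrder L]
    (hTh : #Th = Order.succ (Order.succ (Order.succ #K))) (hK : #K < ℵ_ (#K).ord)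
    (hL : #L = Order.succ (ℵ_ (#K).ord)) (h : HasSys K Th) : HasSys K L := by
  have hK₀ := RegularOrder.aleph0_le (X := K)
  have hTh₀ := RegularOrder.aleph0_le (X := Th)
  set μ := ℵ_ (#K).ord with hμ
  have hs₁ : (Order.succ #K).IsRegular := Cardinal.isRegular_succ hK₀
  have hs₂ : (Order.succ (Order.succ #K)).IsRegular := Cardinal.isRegular_succ hs₁.1
  let W₁ := (Order.succ #K).ord.ToType
  let V₂ := (Order.succ (Order.succ #K)).ord.ToType
  have : RegularOrder W₁ := regularOrder_toType hs₁
  have : RegularOrder V₂ := regularOrder_toType hs₂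
  have h₁ : #K < #W₁ := by simp [W₁]
  have h₂ : #W₁ < #V₂ := by simp [W₁, V₂]
  have h₃ : #V₂ < #Th := by simp [V₂, hTh]
  have hThμ : #Th < μ := by
    rw [hTh]
    exact succ_lt_aleph_ord hK₀ (succ_lt_aleph_ord hK₀ (succ_lt_aleph_ord hK₀ hK))
  have hμL : μ < #L := hL ▸ Order.lt_succ _
  have hμ₀ : ℵ₀ ≤ μ := Cardinal.aleph0_le_aleph _
  let o : K → Ordinal.{0} := fun i => Ordinal.typein (α := K) (· < ·) i
  let ν : K → Cardinal.{0} := fun i => max (ℵ_ (o i)) #Th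
  have hν₀ : ∀ i, ℵ₀ ≤ ν i := fun i => hTh₀.trans (le_max_right _ _)
  have hνμ : ∀ i, ν i < μ := fun i => by
    refine max_lt (Cardinal.aleph_lt_aleph.2 (Cardinal.lt_ord.2 ?_)) hThμ
    rw [Ordinal.card_typein]
    exact RegularOrder.mk_Iio_lt i
  have hνmono : ∀ i j, i ≤ j → ν i ≤ ν j := fun i j hij =>
    max_le_max (Cardinal.aleph_le_aleph.2 ((Ordinal.typein_le_typein _).2 (not_lt.2 hij))) le_rfl
  have hreg : ∀ i, (Order.succ (ν i)).IsRegular := fun i => Cardinal.isRegular_succ (hν₀ i)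
  let V : K → Type := fun i => (Order.succ (ν i)).ord.ToType
  let V' : K → Type := fun i => (ν i).ord.ToType
  have : ∀ i, RegularOrder (V i) := fun i => regularOrder_toType (hreg i)
  have hV : ∀ i, #(V i) = Order.succ (ν i) := fun i => by simp [V]
  have hV' : ∀ i, #(V' i) = ν i := fun i => by simp [V']
  have hThV : ∀ i, #Th < #(V i) := fun i => by
    rw [hV i, Order.lt_succ_iff]
    exact le_max_right _ _
  have hU : #(Σ i, V i) < #L := by
    refine lt_of_le_of_lt ?_ hμL
    rw [Cardinal.mk_sigma]
    refine (Cardinal.sum_le_sum _ (fun _ => μ) fun i => ?_).trans ?_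
    · rw [hV i]
      exact (succ_lt_aleph_ord hK₀ (hνμ i)).le
    · rw [Cardinal.sum_const']
      exact Cardinal.mul_le_of_le hμ₀ hK.le le_rfl
  have hμV' : μ ≤ #(Σ i, V' i) := by
    rw [hμ, Cardinal.aleph_limit (Cardinal.isSuccLimit_ord hK₀)]
    refine ciSup_le' fun α => ?_
    obtain ⟨i, hi⟩ := Ordinal.typein_surj (α := K) (· < ·)
      (lt_of_lt_of_le α.2 (Cardinal.ord_le_type _))
    rw [Cardinal.mk_sigma]
    refine le_trans ?_ (Cardinal.le_sum _ i)
    rw [hV' i, ← hi]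
    exact le_max_left _ _
  have hemb : ∀ γ : L, ∃ e : L → Σ i, V' i, Set.InjOn e (Set.Iio γ) := by
    intro γ
    have h1 : #(Set.Iio γ) ≤ μ := by
      rw [← Order.lt_succ_iff, ← hL]
      exact RegularOrder.mk_Iio_lt γ
    obtain ⟨e⟩ := h1.trans hμV'
    classical
    obtain ⟨u₀⟩ : Nonempty (Σ i, V' i) :=
      Cardinal.mk_ne_zero_iff.1 (Cardinal.aleph0_pos.trans_le (hμ₀.trans hμV')).ne'
    refine ⟨fun α => if h : α < γ then e ⟨α, h⟩ else u₀, fun α hα α' hα' h => ?_⟩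
    simp only [Set.mem_Iio] at hα hα'
    simp only [hα, hα', dite_true] at h
    exact congrArg Subtype.val (e.injective h)
  choose e he using hemb
  obtain ⟨f, hf⟩ := exists_isScale (W := Th) V (hK₀.trans_lt ((h₁.trans h₂).trans h₃)) hThV
    (fun γ α => (e γ α).1) fun γ i => by
      rw [hV i, Order.lt_succ_iff]
      have h1 : #{α | α < γ ∧ (e γ α).1 ≤ i} ≤ #(Σ j : Set.Iic i, V' j) := by
        refine Cardinal.mk_le_of_injective
          (f := fun α => ⟨⟨(e γ α).1, α.2.2⟩, (e γ α).2⟩) fun α α' h => ?_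
        refine Subtype.ext (he γ α.2.1 α'.2.1 ?_)
        exact congrArg (fun p : Σ j : Set.Iic i, V' j => (⟨p.1, p.2⟩ : Σ i, V' i)) h
      refine h1.trans ?_
      rw [Cardinal.mk_sigma]
      refine (Cardinal.sum_le_sum _ (fun _ => ν i) fun j => ?_).trans ?_
      · rw [hV' j]
        exact hνmono _ _ j.2
      · rw [Cardinal.sum_const']
        refine Cardinal.mul_le_of_le (hν₀ i) ?_ le_rfl
        exact (Cardinal.mk_set_le _).trans (((h₁.trans h₂).trans h₃).le.trans (le_max_right _ _))
  obtain ⟨S, a, ha⟩ := exists_isLadderSystem Th L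
  let φ : L → K → Σ i, V i := fun δ i => ⟨i, f δ i⟩
  refine h.attach (hThμ.trans hμL) hU φ a S ha fun β => ?_
  refine ha.goodOrder h₁ (h₂.trans h₃) hThμ (fun D hD => ?_) ha.mk_freqMeets_le _
    Set.inter_subset_left ?_
  · exact mk_freqMeets_le φ ((h₁.trans h₂).trans h₃).le hK
      (fun Y hY => hf.mk_meeting_le h₁ h₂ h₃ (hThμ.trans hμL) Y hY)
      (fun τ h h' => cof_ord_ne_of_lt_aleph_ord hK₀ h h') D hD
  · rw [← Order.lt_succ_iff, ← hL]
    exact (Cardinal.mk_le_mk_of_subset Set.inter_subset_right).trans_lt (RegularOrder.mk_Iio_lt β)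

/-- A regular cardinal `c` carrying a diagonal system of relations. -/
def HasDiagSys (c : Cardinal.{0}) : Prop :=
  ∃ (K : Type) (_ : LinearOrder K), RegularOrder K ∧ #K = c ∧ HasSys K K

theorem hasDiagSys_aleph0 : HasDiagSys ℵ₀ := ⟨ℕ, _, inferInstance, by simp, hasSys_nat⟩

theorem HasDiagSys.succ_aleph_ord {c : Cardinal.{0}} (h : HasDiagSys c) (hc : c < ℵ_ c.ord) :
    HasDiagSys (Order.succ (ℵ_ c.ord)) := by
  obtain ⟨K, _, _, rfl, hK⟩ := h
  have hK₀ := RegularOrder.aleph0_le (X := K)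
  have := RegularOrder.nonempty' K
  have hstep : ∀ (Th : Type) [LinearOrder Th] [RegularOrder Th], HasSys K Th →
      ∃ (Th' : Type) (_ : LinearOrder Th'), RegularOrder Th' ∧ #Th' = Order.succ #Th ∧
        HasSys K Th' := by
    intro Th _ _ h
    have hreg := regularOrder_toType (Cardinal.isRegular_succ (RegularOrder.aleph0_le (X := Th)))
    exact ⟨_, _, hreg, by simp, h.succ (by simp)⟩
  obtain ⟨T₁, _, _, e₁, h₁⟩ := hstep K hK
  obtain ⟨T₂, _, _, e₂, h₂⟩ := hstep T₁ h₁
  obtain ⟨T₃, _, _, e₃, h₃⟩ := hstep T₂ h₂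
  have hreg := regularOrder_toType (Cardinal.isRegular_succ (Cardinal.aleph0_le_aleph (#K).ord))
  refine ⟨_, _, hreg, by simp, HasSys.diagonal (K := K) ?_⟩
  exact h₃.succ_aleph_ord (by rw [e₃, e₂, e₁]) hc (by simp)

theorem exists_hasDiagSys_ge {lam : Cardinal.{0}} (hfix : ∀ c : Cardinal.{0}, ℵ₀ < c →
    Cardinal.aleph c.ord = c → lam < c) : ∃ c, lam ≤ c ∧ HasDiagSys c := by
  by_contra! hcon
  let κ : ℕ → Cardinal.{0} := fun n => (fun c => Order.succ (ℵ_ c.ord))^[n] ℵ₀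
  have hκ : ∀ n, κ (n + 1) = Order.succ (ℵ_ (κ n).ord) := fun n =>
    Function.iterate_succ_apply' _ _ _
  have hsys : ∀ n, HasDiagSys (κ n) := by
    intro n
    induction n with
    | zero => exact hasDiagSys_aleph0
    | succ n ih =>
      rw [hκ n]
      refine ih.succ_aleph_ord (lt_of_le_of_ne (Cardinal.le_aleph_ord _) fun h => ?_)
      rcases lt_or_ge ℵ₀ (κ n) with h' | h'
      · exact hcon _ (hfix _ h' h.symm).le ih
      · have h1 : ℵ₀ < ℵ_ (κ n).ord := by
          obtain ⟨K, _, _, hK, _⟩ := ih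
          rw [← Cardinal.aleph_zero, Cardinal.aleph_lt_aleph]
          exact (Cardinal.isSuccLimit_ord (hK ▸ RegularOrder.aleph0_le)).bot_lt
        exact absurd (h1.trans_le (h ▸ h')) (lt_irrefl _)
  have hlt : ∀ n, κ n < lam := fun n => not_le.1 fun h => hcon _ h (hsys n)
  have hbdd : BddAbove (Set.range κ) := ⟨lam, by rintro _ ⟨n, rfl⟩; exact (hlt n).le⟩
  have hlt' : ∀ n, ℵ_ (κ n).ord < κ (n + 1) := fun n => by
    rw [hκ n]
    exact Order.lt_succ _
  have h0 : ℵ₀ < ⨆ n, κ n := by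
    have h1 : ℵ₀ < κ 1 := (Cardinal.aleph0_le_aleph _).trans_lt (hlt' 0)
    exact h1.trans_le (le_ciSup hbdd 1)
  refine absurd (hfix (⨆ n, κ n) h0 ?_) (not_lt.2 (ciSup_le fun n => (hlt n).le))
  refine le_antisymm ?_ (Cardinal.le_aleph_ord _)
  rw [Cardinal.aleph_limit (Cardinal.isSuccLimit_ord h0.le)]
  refine ciSup_le' fun α => ?_
  obtain ⟨n, hn⟩ := (lt_ciSup_iff hbdd).1 (Cardinal.lt_ord.1 α.2)
  refine le_trans ?_ (le_ciSup hbdd (n + 1))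
  exact (Cardinal.aleph_le_aleph.2 (Cardinal.lt_ord.2 hn).le).trans (hlt' n).le

/-- For every infinite cardinal `λ` smaller than the first fixed point of the aleph
function (the least `α` with `α = ℵ_α > ℵ₀`), there is an abelian group which is
`λ`-free (every subgroup of cardinality `< λ` is a free `ℤ`-module) but not free. -/
theorem statement0 (lam : Cardinal.{0}) (hlam : ℵ₀ ≤ lam)
    (hfix : ∀ c : Cardinal.{0}, ℵ₀ < c → Cardinal.aleph c.ord = c → lam < c) :
    ∃ G : BundledAbGroup,
      (∀ H : AddSubgroup G.carrier, #H < lam → Module.Free ℤ H) ∧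
      ¬ Module.Free ℤ G.carrier := by
  obtain ⟨c, hc, K, _, _, rfl, h⟩ := exists_hasDiagSys_ge hfix
  have := RegularOrder.nonempty' K
  obtain ⟨G, _, hG, hG'⟩ := h.exists_group
  exact ⟨⟨G⟩, fun H hH => hG H (hH.trans_le hc), hG'⟩
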